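/- arXiv:1912.02143 — 2 statements merged into one kernel-verified Lean document; each statement's English description precedes it below -/
import Mathlib

section
/- Complexity at finite n: For any open interval B ⊆ ℝ, E[Crit_{n,L₁}(B)] = C_n · exp(n(1 + ln α)/2) · E_y[ 1{(1/m) Σ_μ φ(y_μ) ∈ B} · exp(−((n−1)/2) ln((1/m) Σ_μ φ'(y_μ)²)) · E_z[ |det H_n^Λ(y)| ] ], where C_n satisfies lim_{n→∞} (1/n) ln C_n = 0, y ~ N(0, I_m), and z ∈ ℝ^{(n−1)×m} has i.i.d. standard Gaussian entries independent of y. -/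
/- STATEMENT 4: the complexity at finite n (Lemma 2.3 of the paper):
E[Crit_{n,L₁}(B)] = C_n e^{n(1+ln α)/2}
   E_y[ 1{(1/m)∑φ(y_μ)∈B} e^{−((n−1)/2) ln((1/m)∑φ'(y_μ)²)} E_z|det H_n^Λ(y)| ],
with (1/n) ln C_n → 0, y ~ N(0,I_m), z an (n−1)×m iid standard Gaussian matrix. -/

open MeasureTheory Matrix Filter Topology Real Set ProbabilityTheory
open scoped ENNReal NNReal Classical

noncomputable section

abbrev stdGauss : Measure ℝ := gaussianReal 0 1

def gaussVec (k : ℕ) : Measure (Fin k → ℝ) := Measure.pi fun _ => stdGauss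

def gaussMat (a b : ℕ) : Measure (Fin a → Fin b → ℝ) :=
  Measure.pi fun _ => Measure.pi fun _ => stdGauss

def dotp {k : ℕ} (u v : Fin k → ℝ) : ℝ := ∑ i, u i * v i

def L1 (φ : ℝ → ℝ) {n m : ℕ} (ξ : Fin m → Fin n → ℝ) (x : Fin n → ℝ) : ℝ :=
  (1 / (m : ℝ)) * ∑ μ, φ (dotp (ξ μ) x)

def gradL1 (φ : ℝ → ℝ) {n m : ℕ} (ξ : Fin m → Fin n → ℝ) (x : Fin n → ℝ) :
    Fin n → ℝ :=
  fun i => (1 / (m : ℝ)) * ∑ μ, deriv φ (dotp (ξ μ) x) * (ξ μ i - dotp (ξ μ) x * x i)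

def CritSet (φ : ℝ → ℝ) {n m : ℕ} (ξ : Fin m → Fin n → ℝ) (B : Set ℝ) :
    Set (Fin n → ℝ) :=
  {x | dotp x x = 1 ∧ gradL1 φ ξ x = 0 ∧ L1 φ ξ x ∈ B}

def ECrit (φ : ℝ → ℝ) (n m : ℕ) (B : Set ℝ) : ℝ≥0∞ :=
  ∫⁻ ξ, ((CritSet φ ξ B).encard : ℝ≥0∞) ∂(gaussMat m n)

/-- Orthogonal projection `I_m − φ'(y)φ'(y)ᵀ/‖φ'(y)‖²`. -/
def Pperp (φ : ℝ → ℝ) {m : ℕ} (y : Fin m → ℝ) : Matrix (Fin m) (Fin m) ℝ :=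
  1 - Matrix.of (fun μ ν => deriv φ (y μ) * deriv φ (y ν) / ∑ ρ, (deriv φ (y ρ)) ^ 2)

/-- Diagonal matrix `D(y)` with entries `(n/m) φ''(y_μ)`. -/
def Dmat (φ : ℝ → ℝ) (n : ℕ) {m : ℕ} (y : Fin m → ℝ) : Matrix (Fin m) (Fin m) ℝ :=
  Matrix.diagonal fun μ => ((n : ℝ) / m) * deriv (deriv φ) (y μ)

/-- `Λ(y) = P_⊥ D(y) P_⊥`. -/
def Lam (φ : ℝ → ℝ) (n : ℕ) {m : ℕ} (y : Fin m → ℝ) : Matrix (Fin m) (Fin m) ℝ :=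
  Pperp φ y * Dmat φ n y * Pperp φ y

/-- `H_n^Λ(y) = (1/n) z Λ(y) zᵀ − [(1/m) ∑_μ y_μ φ'(y_μ)] I_{n−1}`. -/
def Hmat (φ : ℝ → ℝ) (n : ℕ) {m : ℕ} (y : Fin m → ℝ)
    (z : Fin (n - 1) → Fin m → ℝ) : Matrix (Fin (n - 1)) (Fin (n - 1)) ℝ :=
  ((n : ℝ)⁻¹) • (Matrix.of z * Lam φ n y * (Matrix.of z)ᵀ) -
    ((1 / (m : ℝ)) * ∑ μ, y μ * deriv φ (y μ)) • 1

/-- `E_z |det H_n^Λ(y)|`. -/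
def Edet (φ : ℝ → ℝ) (n m : ℕ) (y : Fin m → ℝ) : ℝ :=
  ∫ z, |Matrix.det (Hmat φ n y z)| ∂(gaussMat (n - 1) m)

section Area

variable {E : Type*} [NormedAddCommGroup E] [NormedSpace ℝ E] [FiniteDimensional ℝ E]

/-- The points of an open set where a `C¹` map has invertible derivative are covered by countably
many open sets on which the map is injective. -/
lemma exists_seq_open_injOn {f : E → E} {U : Set E} (hU : IsOpen U) (hf : ContDiffOn ℝ 1 f U) :
    ∃ V : ℕ → Set E, (∀ k, IsOpen (V k)) ∧ (∀ k, InjOn f (V k)) ∧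
      {x ∈ U | (fderiv ℝ f x).det ≠ 0} ⊆ ⋃ k, V k := by
  set s := {x ∈ U | (fderiv ℝ f x).det ≠ 0} with hs
  have key : ∀ x ∈ s, ∃ V : Set E, IsOpen V ∧ x ∈ V ∧ InjOn f V := by
    rintro x ⟨hxU, hdet⟩
    have hc : ContDiffAt ℝ 1 f x := hf.contDiffAt (hU.mem_nhds hxU)
    have hst : HasStrictFDerivAt f (fderiv ℝ f x) x := hc.hasStrictFDerivAt one_ne_zero
    let L : E ≃L[ℝ] E := ContinuousLinearMap.toContinuousLinearEquivOfDetNeZero _ hdet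
    have hL : HasStrictFDerivAt f (L : E →L[ℝ] E) x := by
      simpa [L] using hst
    exact ⟨(hL.toOpenPartialHomeomorph f).source, (hL.toOpenPartialHomeomorph f).open_source,
      hL.mem_toOpenPartialHomeomorph_source, (hL.toOpenPartialHomeomorph f).injOn⟩
  choose! V hVo hxV hVi using key
  obtain ⟨t, hts, htc, hcov⟩ := TopologicalSpace.countable_cover_nhdsWithin (s := s) (f := V)
    fun x hx => mem_nhdsWithin_of_mem_nhds ((hVo x hx).mem_nhds (hxV x hx))
  rcases t.eq_empty_or_nonempty with rfl | hne
  · refine ⟨fun _ => ∅, by simp, by simp, ?_⟩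
    simpa using hcov
  · obtain ⟨e, rfl⟩ := htc.exists_eq_range hne
    refine ⟨fun k => V (e k), fun k => hVo _ (hts ⟨k, rfl⟩), fun k => hVi _ (hts ⟨k, rfl⟩), ?_⟩
    simpa using hcov

variable [MeasurableSpace E] [BorelSpace E]

/-- Area formula for `C¹` maps between open sets of the same finite-dimensional space. -/
lemma lintegral_encard_fiber (μ : Measure E) [μ.IsAddHaarMeasure] {f : E → E} {U A : Set E}
    (hU : IsOpen U) (hf : ContDiffOn ℝ 1 f U) (hA : MeasurableSet A) (hAU : A ⊆ U)
    {w : E → ℝ≥0∞} (hw : Measurable w) :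
    AEMeasurable (fun ξ => ((A ∩ f ⁻¹' {ξ}).encard : ℝ≥0∞) * w ξ) μ ∧
    ∫⁻ ξ, ((A ∩ f ⁻¹' {ξ}).encard : ℝ≥0∞) * w ξ ∂μ =
      ∫⁻ x in A, ENNReal.ofReal |(fderiv ℝ f x).det| * w (f x) ∂μ := by
  obtain ⟨V, hVo, hVi, hcov⟩ := exists_seq_open_injOn hU hf
  have hcont : ContinuousOn (fun x => (fderiv ℝ f x).det) U :=
    ContinuousLinearMap.continuous_det.comp_continuousOn
      (hf.continuousOn_fderiv_of_isOpen hU le_rfl)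
  have hUdet : IsOpen {x ∈ U | (fderiv ℝ f x).det ≠ 0} :=
    hcont.isOpen_inter_preimage hU isOpen_compl_singleton
  set s := {x ∈ U | (fderiv ℝ f x).det ≠ 0} with hs
  set P : ℕ → Set E := fun k => A ∩ s ∩ disjointed V k with hP
  have hPm : ∀ k, MeasurableSet (P k) := fun k =>
    (hA.inter hUdet.measurableSet).inter
      (MeasurableSet.disjointed (fun i => (hVo i).measurableSet) k)
  have hPd : Pairwise (Function.onFun Disjoint P) := fun i j hij =>
    (disjoint_disjointed V hij).mono inter_subset_right inter_subset_right
  have hPU : ⋃ k, P k = A ∩ s := by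
    rw [hP, ← inter_iUnion, iUnion_disjointed]
    exact inter_eq_left.2 (inter_subset_right.trans hcov)
  have hPi : ∀ k, InjOn f (P k) := fun k =>
    (hVi k).mono (inter_subset_right.trans (disjointed_subset V k))
  have hfd : ∀ x ∈ U, HasFDerivAt f (fderiv ℝ f x) x := fun x hx =>
    ((hf.contDiffAt (hU.mem_nhds hx)).differentiableAt one_ne_zero).hasFDerivAt
  have hPsubU : ∀ k, P k ⊆ U := fun k x hx => hAU hx.1.1
  have hPim : ∀ k, MeasurableSet (f '' P k) := fun k =>
    measurable_image_of_fderivWithin (hPm k)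
      (fun x hx => (hfd x (hPsubU k hx)).hasFDerivWithinAt) (hPi k)
  have hsard : μ (f '' (A \ s)) = 0 := by
    refine addHaar_image_eq_zero_of_det_fderivWithin_eq_zero μ
      (f' := fderiv ℝ f) (fun x hx => (hfd x (hAU hx.1)).hasFDerivWithinAt) fun x hx => ?_
    by_contra hne
    exact hx.2 ⟨hAU hx.1, hne⟩
  have hcount : ∀ ξ ∉ f '' (A \ s), ((A ∩ f ⁻¹' {ξ}).encard : ℝ≥0∞) * w ξ =
      ∑' k, (f '' P k).indicator w ξ := by
    intro ξ hξ
    have hsub : ∀ k, (P k ∩ f ⁻¹' {ξ}).Subsingleton := fun k x hx y hy =>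
      hPi k hx.1 hy.1 (hx.2.trans hy.2.symm)
    have h1 : A ∩ f ⁻¹' {ξ} = ⋃ k, (P k ∩ f ⁻¹' {ξ}) := by
      rw [← iUnion_inter, hPU]
      ext x
      constructor
      · rintro ⟨hx, hxξ⟩
        refine ⟨⟨hx, ?_⟩, hxξ⟩
        by_contra hxs
        exact hξ ⟨x, ⟨hx, hxs⟩, hxξ⟩
      · rintro ⟨⟨hx, -⟩, hxξ⟩
        exact ⟨hx, hxξ⟩
    have hm : ∀ k, MeasurableSet (P k ∩ f ⁻¹' {ξ}) := fun k => (hsub k).measurableSet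
    rw [h1, ← Measure.count_apply (MeasurableSet.iUnion hm), measure_iUnion
      (fun i j hij => (hPd hij).mono inter_subset_left inter_subset_left) hm,
      ← ENNReal.tsum_mul_right]
    refine tsum_congr fun k => ?_
    rw [Measure.count_apply (hm k)]
    by_cases hk : ξ ∈ f '' P k
    · obtain ⟨x, hx, rfl⟩ := hk
      have : P k ∩ f ⁻¹' {f x} = {x} :=
        (hsub k).eq_singleton_of_mem ⟨hx, rfl⟩
      rw [this, indicator_of_mem (mem_image_of_mem f hx)]
      simp
    · have : P k ∩ f ⁻¹' {ξ} = ∅ := by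
        ext x
        simp only [mem_inter_iff, mem_preimage, mem_singleton_iff, mem_empty_iff_false, iff_false]
        exact fun h => hk ⟨x, h⟩
      rw [this, indicator_of_notMem hk]
      simp
  have hae : ∀ᵐ ξ ∂μ, ((A ∩ f ⁻¹' {ξ}).encard : ℝ≥0∞) * w ξ =
      ∑' k, (f '' P k).indicator w ξ := by
    filter_upwards [measure_eq_zero_iff_ae_notMem.1 hsard] with ξ hξ using hcount ξ hξ
  refine ⟨⟨_, Measurable.tsum fun k => hw.indicator (hPim k), hae⟩, ?_⟩
  rw [lintegral_congr_ae hae, lintegral_tsum fun k => (hw.indicator (hPim k)).aemeasurable]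
  have hk : ∀ k, ∫⁻ ξ, (f '' P k).indicator w ξ ∂μ =
      ∫⁻ x in P k, ENNReal.ofReal |(fderiv ℝ f x).det| * w (f x) ∂μ := fun k => by
    rw [lintegral_indicator (hPim k)]
    exact lintegral_image_eq_lintegral_abs_det_fderiv_mul μ (hPm k)
      (fun x hx => (hfd x (hPsubU k hx)).hasFDerivWithinAt) (hPi k) w
  rw [tsum_congr hk, ← lintegral_iUnion hPm hPd, hPU,
    ← lintegral_inter_add_sdiff _ A hUdet.measurableSet]
  have hz : ∫⁻ x in A \ s, ENNReal.ofReal |(fderiv ℝ f x).det| * w (f x) ∂μ = 0 := by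
    rw [setLIntegral_congr_fun (g := fun _ => 0) (hA.diff hUdet.measurableSet), lintegral_zero]
    intro x hx
    have : (fderiv ℝ f x).det = 0 := by
      by_contra hne
      exact hx.2 ⟨hAU hx.1, hne⟩
    simp [this]
  rw [hz, add_zero]

end Area

section Product

variable {X : Type*} [MeasurableSpace X]

lemma lintegral_pi_cons {k : ℕ} (μ : Fin (k + 1) → Measure X) [∀ i, SigmaFinite (μ i)]
    {f : (Fin (k + 1) → X) → ℝ≥0∞} (hf : Measurable f) :
    ∫⁻ ω, f ω ∂(Measure.pi μ) =
      ∫⁻ x, ∫⁻ η, f (Fin.cons x η) ∂(Measure.pi fun i : Fin k => μ i.succ) ∂(μ 0) := by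
  have h := (measurePreserving_piFinSuccAbove μ 0).symm
  rw [← h.lintegral_comp hf]
  simp only [Fin.succAbove_zero]
  have hm : Measurable fun a : X × (Fin k → X) =>
      f ((MeasurableEquiv.piFinSuccAbove (fun _ => X) 0).symm a) :=
    hf.comp (MeasurableEquiv.measurable _)
  rw [lintegral_prod _ hm.aemeasurable]
  refine lintegral_congr fun x => lintegral_congr fun η => ?_
  congr 1
  exact Fin.insertNth_zero' x η

lemma lintegral_volume_cons {X : Type*} [MeasureSpace X] [SigmaFinite (volume : Measure X)]
    {k : ℕ} {f : (Fin (k + 1) → X) → ℝ≥0∞} (hf : Measurable f) :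
    ∫⁻ ω, f ω = ∫⁻ x, ∫⁻ η : Fin k → X, f (Fin.cons x η) :=
  lintegral_pi_cons (fun _ => volume) hf

lemma measurable_cons {k : ℕ} :
    Measurable fun p : X × (Fin k → X) => (Fin.cons p.1 p.2 : Fin (k + 1) → X) := by
  refine measurable_pi_iff.2 fun i => ?_
  refine Fin.cases ?_ (fun j => ?_) i
  · simpa using measurable_fst
  · simp only [Fin.cons_succ]
    fun_prop

lemma lintegral_pi_prod {k : ℕ} (μ : Fin k → Measure X) [∀ i, SigmaFinite (μ i)]
    {f : Fin k → X → ℝ≥0∞} (hf : ∀ i, Measurable (f i)) :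
    ∫⁻ ω, ∏ i, f i (ω i) ∂(Measure.pi μ) = ∏ i, ∫⁻ x, f i x ∂(μ i) := by
  induction k with
  | zero => simp
  | succ k ih =>
    have hm' : Measurable fun η : Fin (k + 1) → X => ∏ i, f i (η i) :=
      Finset.measurable_prod _ fun i _ => (hf i).comp (measurable_pi_apply i)
    rw [lintegral_pi_cons μ hm']
    simp only [Fin.prod_univ_succ, Fin.cons_zero, Fin.cons_succ]
    have hm : Measurable fun η : Fin k → X => ∏ i : Fin k, f i.succ (η i) :=
      Finset.measurable_prod _ fun i _ => (hf i.succ).comp (measurable_pi_apply i)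
    simp_rw [lintegral_const_mul _ hm]
    rw [lintegral_mul_const _ (hf 0), ih (fun i => μ i.succ) fun i => hf i.succ]

lemma pi_withDensity {k : ℕ} (μ : Measure X) [SigmaFinite μ] {g : X → ℝ≥0∞} (hg : Measurable g)
    [SigmaFinite (μ.withDensity g)] :
    Measure.pi (fun _ : Fin k => μ.withDensity g) =
      (Measure.pi fun _ : Fin k => μ).withDensity fun x => ∏ i, g (x i) := by
  symm
  refine (Measure.pi_eq fun s hs => ?_).symm
  rw [withDensity_apply _ (MeasurableSet.univ_pi hs), Measure.restrict_pi_pi,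
    lintegral_pi_prod (fun i => μ.restrict (s i)) fun _ => hg]
  exact Finset.prod_congr rfl fun i _ => (withDensity_apply g (hs i)).symm

end Product

section GaussWeight

/-- The standard Gaussian density in dimension `d`, as a function of the squared norm. -/
def gaussWeight (d : ℕ) (s : ℝ) : ℝ≥0∞ :=
  ENNReal.ofReal (((√(2 * π))⁻¹) ^ d * rexp (-s / 2))

lemma gaussWeight_mul (d e : ℕ) (s t : ℝ) :
    gaussWeight d s * gaussWeight e t = gaussWeight (d + e) (s + t) := by
  unfold gaussWeight
  rw [← ENNReal.ofReal_mul (by positivity)]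
  congr 1
  rw [show -(s + t) / 2 = -s / 2 + -t / 2 by ring, Real.exp_add, pow_add]
  ring

lemma gaussWeight_add (d : ℕ) (s t : ℝ) :
    gaussWeight d (s + t) = gaussWeight d s * ENNReal.ofReal (rexp (-t / 2)) := by
  unfold gaussWeight
  rw [← ENNReal.ofReal_mul (by positivity), show -(s + t) / 2 = -s / 2 + -t / 2 by ring,
    Real.exp_add, mul_assoc]

lemma measurable_gaussWeight (d : ℕ) : Measurable (gaussWeight d) := by
  unfold gaussWeight
  fun_prop

lemma prod_gaussWeight {k : ℕ} (d : ℕ) (s : Fin k → ℝ) :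
    ∏ i, gaussWeight d (s i) = gaussWeight (k * d) (∑ i, s i) := by
  unfold gaussWeight
  rw [← ENNReal.ofReal_prod_of_nonneg fun i _ => by positivity]
  congr 1
  rw [Finset.prod_mul_distrib, ← Real.exp_sum, neg_div, Finset.sum_div, ← Finset.sum_neg_distrib]
  simp [neg_div, ← pow_mul, mul_comm]

lemma gaussVec_eq (k : ℕ) :
    gaussVec k = (volume : Measure (Fin k → ℝ)).withDensity fun y => gaussWeight k (dotp y y) := by
  have h1 : stdGauss = (volume : Measure ℝ).withDensity (gaussianPDF 0 1) :=
    gaussianReal_of_var_ne_zero 0 one_ne_zero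
  have : SigmaFinite ((volume : Measure ℝ).withDensity (gaussianPDF 0 1)) := by
    rw [← h1]; infer_instance
  unfold gaussVec
  rw [h1, pi_withDensity _ (measurable_gaussianPDF 0 1)]
  congr 1
  ext y
  have : ∀ i, gaussianPDF 0 1 (y i) = gaussWeight 1 (y i * y i) := fun i => by
    simp [gaussianPDF, gaussianPDFReal, gaussWeight, sq]
  simp_rw [this, prod_gaussWeight, mul_one]
  rfl

instance (k : ℕ) : IsProbabilityMeasure (gaussVec k) := by
  unfold gaussVec; infer_instance

instance (a b : ℕ) : IsProbabilityMeasure (gaussMat a b) := by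
  unfold gaussMat; infer_instance

lemma measurable_dotp_self (k : ℕ) : Measurable fun y : Fin k → ℝ => dotp y y := by
  unfold dotp; fun_prop

lemma gaussMat_eq (a b : ℕ) :
    gaussMat a b = (volume : Measure (Fin a → Fin b → ℝ)).withDensity
      fun z => gaussWeight (a * b) (∑ i, dotp (z i) (z i)) := by
  have h1 := gaussVec_eq b
  have : SigmaFinite ((volume : Measure (Fin b → ℝ)).withDensity
      fun y => gaussWeight b (dotp y y)) := by
    rw [← h1]; infer_instance
  have h2 : gaussMat a b = Measure.pi fun _ : Fin a => gaussVec b := rfl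
  have hm : Measurable fun y : Fin b → ℝ => gaussWeight b (dotp y y) :=
    (measurable_gaussWeight b).comp (measurable_dotp_self b)
  rw [h2, h1, pi_withDensity _ hm]
  congr 1
  ext z
  exact prod_gaussWeight b fun i => dotp (z i) (z i)

lemma lintegral_gaussWeight (k : ℕ) :
    ∫⁻ y : Fin k → ℝ, gaussWeight k (dotp y y) = 1 := by
  have h : gaussVec k univ = 1 := measure_univ
  rwa [gaussVec_eq, withDensity_apply _ MeasurableSet.univ, Measure.restrict_univ] at h

lemma lintegral_comp_smul_add {N : ℕ} {c : ℝ} (hc : c ≠ 0) (b : Fin N → ℝ)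
    {f : (Fin N → ℝ) → ℝ≥0∞} (hf : Measurable f) :
    ∫⁻ x, f x = ENNReal.ofReal (|c| ^ N) * ∫⁻ s, f (c • s + b) := by
  rw [← lintegral_add_right_eq_self f b,
    ← lintegral_map (f := fun x => f (x + b)) (by fun_prop) (measurable_const_smul c),
    Measure.map_addHaar_smul _ hc, lintegral_smul_measure, smul_eq_mul, ← mul_assoc,
    ← ENNReal.ofReal_mul (by positivity)]
  simp [abs_inv, abs_pow, hc]

lemma lintegral_exp_scaled {N : ℕ} {t : ℝ} (ht : 0 < t) :
    ∫⁻ s : Fin N → ℝ, ENNReal.ofReal (rexp (-(t ^ 2 * dotp s s) / 2)) =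
      ENNReal.ofReal (√(2 * π) ^ N * (t ^ N)⁻¹) := by
  have h1 := lintegral_comp_smul_add (N := N) ht.ne' 0
    (f := fun x => gaussWeight N (dotp x x))
    ((measurable_gaussWeight N).comp (measurable_dotp_self N))
  rw [lintegral_gaussWeight] at h1
  have h2 : ∀ s : Fin N → ℝ, gaussWeight N (dotp (t • s + 0) (t • s + 0)) =
      ENNReal.ofReal (((√(2 * π))⁻¹) ^ N) *
        ENNReal.ofReal (rexp (-(t ^ 2 * dotp s s) / 2)) := fun s => by
    unfold gaussWeight
    rw [ENNReal.ofReal_mul (by positivity)]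
    congr 5
    simp only [dotp, add_zero, Pi.smul_apply, smul_eq_mul, Finset.mul_sum]
    exact Finset.sum_congr rfl fun i _ => by ring
  simp_rw [h2] at h1
  rw [lintegral_const_mul' _ _ ENNReal.ofReal_ne_top, ← mul_assoc,
    ← ENNReal.ofReal_mul (by positivity)] at h1
  have h3 : ENNReal.ofReal (√(2 * π) ^ N * (t ^ N)⁻¹) *
      ENNReal.ofReal (|t| ^ N * ((√(2 * π))⁻¹) ^ N) = 1 := by
    rw [← ENNReal.ofReal_mul (by positivity), abs_of_pos ht, inv_pow]
    have : √(2 * π) ^ N ≠ 0 := by positivity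
    rw [show √(2 * π) ^ N * (t ^ N)⁻¹ * (t ^ N * (√(2 * π) ^ N)⁻¹) = 1 by
      field_simp]
    simp
  calc _ = 1 * ∫⁻ s : Fin N → ℝ, ENNReal.ofReal (rexp (-(t ^ 2 * dotp s s) / 2)) := by rw [one_mul]
    _ = ENNReal.ofReal (√(2 * π) ^ N * (t ^ N)⁻¹) * 1 := by
      rw [← h3, mul_assoc, ← h1, h3]
    _ = _ := mul_one _

end GaussWeight

section Polar

variable {E : Type*} [NormedAddCommGroup E] [NormedSpace ℝ E] [FiniteDimensional ℝ E]
  [MeasurableSpace E] [BorelSpace E] [Nontrivial E]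

lemma lintegral_fun_norm_addHaar (μ : Measure E) [μ.IsAddHaarMeasure] {f : ℝ → ℝ≥0∞}
    (hf : Measurable f) :
    ∫⁻ x, f ‖x‖ ∂μ = Module.finrank ℝ E * μ (Metric.ball 0 1) *
      ∫⁻ y : ℝ, ENNReal.ofReal (rexp (Module.finrank ℝ E * y)) * f (rexp y) := by
  have hexp : ∫⁻ r in Ioi (0 : ℝ), ENNReal.ofReal (r ^ (Module.finrank ℝ E - 1)) * f r =
      ∫⁻ y : ℝ, ENNReal.ofReal (rexp (Module.finrank ℝ E * y)) * f (rexp y) := by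
    have := lintegral_image_eq_lintegral_abs_deriv_mul (s := univ) (f := rexp) (f' := rexp)
      MeasurableSet.univ (fun x _ => (Real.hasDerivAt_exp x).hasDerivWithinAt)
      Real.exp_injective.injOn (fun r => ENNReal.ofReal (r ^ (Module.finrank ℝ E - 1)) * f r)
    rw [image_univ, Real.range_exp, Measure.restrict_univ] at this
    rw [this]
    refine lintegral_congr fun y => ?_
    rw [← mul_assoc, ← ENNReal.ofReal_mul (by positivity), abs_of_pos (Real.exp_pos y),
      ← pow_succ', Nat.sub_add_cancel Module.finrank_pos, ← Real.exp_nat_mul]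
  rw [← hexp]
  calc
    ∫⁻ x, f ‖x‖ ∂μ = ∫⁻ x : ({(0)}ᶜ : Set E), f ‖x.1‖ ∂(μ.comap (↑)) := by
      rw [lintegral_subtype_comap (measurableSet_singleton _).compl fun x ↦ f ‖x‖,
        restrict_compl_singleton]
    _ = ∫⁻ x, f x.2 ∂μ.toSphere.prod (.volumeIoiPow (Module.finrank ℝ E - 1)) := by
      have h := μ.measurePreserving_homeomorphUnitSphereProd
      rw [← h.lintegral_comp_emb (Homeomorph.measurableEmbedding _)]
      simp
    _ = μ.toSphere univ * ∫⁻ x : Ioi (0 : ℝ), f x ∂.volumeIoiPow (Module.finrank ℝ E - 1) := by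
      have hm : Measurable fun x : Ioi (0 : ℝ) => f x := hf.comp measurable_subtype_coe
      have hm' : Measurable fun x : Metric.sphere (0 : E) 1 × Ioi (0 : ℝ) => f x.2 :=
        hm.comp measurable_snd
      rw [lintegral_prod _ hm'.aemeasurable]
      simp [mul_comm]
    _ = _ := by
      have hm : Measurable fun x : Ioi (0 : ℝ) => f x := hf.comp measurable_subtype_coe
      rw [μ.toSphere_apply_univ, Measure.volumeIoiPow, lintegral_withDensity_eq_lintegral_mul _
        ((measurable_subtype_coe.pow_const _).ennreal_ofReal) hm]
      simp only [Pi.mul_apply]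
      rw [lintegral_subtype_comap measurableSet_Ioi
        fun r => ENNReal.ofReal (r ^ (Module.finrank ℝ E - 1)) * f r]

end Polar

section Disintegration

variable {k N : ℕ}

/-- The row determined by the linear constraint `∑ a_μ Z_μ = 0` and the other rows. -/
def headRow (a : Fin (k + 1) → ℝ) (ζ : Fin k → Fin N → ℝ) : Fin N → ℝ :=
  -((a 0)⁻¹ • ∑ μ, a (Fin.succ μ) • ζ μ)

/-- The unique matrix with rows `ζ` below the first one and orthogonal to `a`. -/
def completeRows (a : Fin (k + 1) → ℝ) (ζ : Fin k → Fin N → ℝ) : Fin (k + 1) → Fin N → ℝ :=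
  Fin.cons (headRow a ζ) ζ

/-- Orthogonal projection of every column of `Z` to the complement of `a`. -/
def projRows (a : Fin (k + 1) → ℝ) (Z : Fin (k + 1) → Fin N → ℝ) : Fin (k + 1) → Fin N → ℝ :=
  fun μ => Z μ - (a μ / ∑ ρ, a ρ ^ 2) • ∑ ρ, a ρ • Z ρ

lemma sum_smul_completeRows {a : Fin (k + 1) → ℝ} (ha : a 0 ≠ 0) (ζ : Fin k → Fin N → ℝ) :
    ∑ μ, a μ • completeRows a ζ μ = 0 := by
  rw [Fin.sum_univ_succ]
  simp only [completeRows, Fin.cons_zero, Fin.cons_succ, headRow, smul_neg, smul_smul,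
    mul_inv_cancel₀ ha, one_smul, neg_add_cancel]

lemma sum_sq_pos_of_ne {a : Fin (k + 1) → ℝ} (ha : a 0 ≠ 0) : 0 < ∑ ρ, a ρ ^ 2 :=
  Finset.sum_pos' (fun _ _ => sq_nonneg _) ⟨0, Finset.mem_univ _, by positivity⟩

lemma projRows_completeRows_add {a : Fin (k + 1) → ℝ} (ha : a 0 ≠ 0) (ζ : Fin k → Fin N → ℝ)
    (s : Fin N → ℝ) :
    projRows a (fun μ => completeRows a ζ μ + a μ • s) = completeRows a ζ := by
  have hA := (sum_sq_pos_of_ne ha).ne'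
  have h : ∑ ρ, a ρ • (completeRows a ζ ρ + a ρ • s) = (∑ ρ, a ρ ^ 2) • s := by
    simp only [smul_add, Finset.sum_add_distrib, sum_smul_completeRows ha, zero_add, smul_smul,
      Finset.sum_smul, sq]
  funext μ
  simp only [projRows]
  rw [h, smul_smul, div_mul_cancel₀ _ hA, add_sub_cancel_right]

lemma sum_dotp_completeRows_add {a : Fin (k + 1) → ℝ} (ha : a 0 ≠ 0) (ζ : Fin k → Fin N → ℝ)
    (s : Fin N → ℝ) :
    ∑ μ, dotp (completeRows a ζ μ + a μ • s) (completeRows a ζ μ + a μ • s) =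
      (∑ μ, dotp (completeRows a ζ μ) (completeRows a ζ μ)) + (∑ ρ, a ρ ^ 2) * dotp s s := by
  have h : ∀ i, ∑ μ, a μ * completeRows a ζ μ i = 0 := fun i => by
    have := congrFun (sum_smul_completeRows ha ζ) i
    simpa using this
  have h2 : ∀ μ, dotp (completeRows a ζ μ + a μ • s) (completeRows a ζ μ + a μ • s) =
      dotp (completeRows a ζ μ) (completeRows a ζ μ) + a μ ^ 2 * dotp s s +
        ∑ i, 2 * s i * (a μ * completeRows a ζ μ i) := fun μ => by
    simp only [dotp, Pi.add_apply, Pi.smul_apply, smul_eq_mul, Finset.mul_sum,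
      ← Finset.sum_add_distrib]
    exact Finset.sum_congr rfl fun i _ => by ring
  simp_rw [h2, Finset.sum_add_distrib]
  rw [Finset.sum_comm]
  simp_rw [← Finset.mul_sum, h, mul_zero, Finset.sum_const_zero, add_zero, ← Finset.sum_mul]

lemma measurable_headRow (a : Fin (k + 1) → ℝ) :
    Measurable (headRow a : (Fin k → Fin N → ℝ) → Fin N → ℝ) := by
  unfold headRow; fun_prop

lemma measurable_completeRows (a : Fin (k + 1) → ℝ) :
    Measurable (completeRows a : (Fin k → Fin N → ℝ) → _) :=
  measurable_cons.comp ((measurable_headRow a).prodMk measurable_id)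

lemma measurable_projRows (a : Fin (k + 1) → ℝ) :
    Measurable (projRows a : (Fin (k + 1) → Fin N → ℝ) → _) := by
  unfold projRows; fun_prop

lemma headRow_add {a : Fin (k + 1) → ℝ} (ha : a 0 ≠ 0) (ζ : Fin k → Fin N → ℝ) (s : Fin N → ℝ) :
    ((∑ ρ, a ρ ^ 2) / a 0) • s + headRow a (ζ + fun μ => a μ.succ • s) =
      headRow a ζ + a 0 • s := by
  funext i
  simp only [headRow, Pi.add_apply, Pi.smul_apply, Pi.neg_apply, smul_eq_mul, Finset.sum_apply,
    Fin.sum_univ_succ, mul_add, Finset.sum_add_distrib]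
  have : ∑ x : Fin k, a x.succ * (a x.succ * s i) = (∑ x : Fin k, a x.succ ^ 2) * s i := by
    rw [Finset.sum_mul]
    exact Finset.sum_congr rfl fun _ _ => by ring
  rw [this]
  field_simp
  ring

/-- Integrating a function of the orthogonal projection of a Gaussian matrix amounts to
integrating over the rows of index at least one. -/
lemma lintegral_completeRows {a : Fin (k + 1) → ℝ} (ha : a 0 ≠ 0)
    {f : (Fin (k + 1) → Fin N → ℝ) → ℝ≥0∞} (hf : Measurable f) :
    ∫⁻ Z, f (projRows a Z) ∂(gaussMat (k + 1) N) =
      ENNReal.ofReal ((√(∑ ρ, a ρ ^ 2) / |a 0|) ^ N * √(2 * π) ^ N) *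
        ∫⁻ ζ : Fin k → Fin N → ℝ, f (completeRows a ζ) *
          gaussWeight ((k + 1) * N)
            (∑ μ, dotp (completeRows a ζ μ) (completeRows a ζ μ)) := by
  set A := ∑ ρ, a ρ ^ 2 with hAdef
  have hA : 0 < A := sum_sq_pos_of_ne ha
  set F : (Fin (k + 1) → Fin N → ℝ) → ℝ≥0∞ := fun Z =>
    gaussWeight ((k + 1) * N) (∑ μ, dotp (Z μ) (Z μ)) * f (projRows a Z) with hF
  have hwm : Measurable fun Z : Fin (k + 1) → Fin N → ℝ =>
      gaussWeight ((k + 1) * N) (∑ μ, dotp (Z μ) (Z μ)) :=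
    (measurable_gaussWeight _).comp
      (Finset.measurable_sum _ fun μ _ => (measurable_dotp_self N).comp (measurable_pi_apply μ))
  have hfp : Measurable fun Z => f (projRows a Z) := hf.comp (measurable_projRows a)
  have hFm : Measurable F := hwm.mul hfp
  have hFc : Measurable fun p : (Fin N → ℝ) × (Fin k → Fin N → ℝ) =>
      F (Fin.cons p.1 p.2) := hFm.comp measurable_cons
  have hA0 : A / a 0 ≠ 0 := div_ne_zero hA.ne' ha
  have h1 : ∫⁻ Z, f (projRows a Z) ∂(gaussMat (k + 1) N) = ∫⁻ Z, F Z := by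
    rw [gaussMat_eq, lintegral_withDensity_eq_lintegral_mul _ hwm hfp]
    rfl
  have h2 : ∫⁻ Z, F Z = ∫⁻ w' : Fin k → Fin N → ℝ, ∫⁻ w : Fin N → ℝ, F (Fin.cons w w') := by
    rw [lintegral_volume_cons hFm, lintegral_lintegral_swap hFc.aemeasurable]
  have h3 : ∀ w' : Fin k → Fin N → ℝ, ∫⁻ w : Fin N → ℝ, F (Fin.cons w w') =
      ENNReal.ofReal (|A / a 0| ^ N) *
        ∫⁻ s : Fin N → ℝ, F (Fin.cons ((A / a 0) • s + headRow a w') w') := fun w' =>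
    lintegral_comp_smul_add hA0 (headRow a w')
      (hFm.comp (measurable_cons.comp (measurable_id.prodMk measurable_const)))
  have hm4 : Measurable fun p : (Fin k → Fin N → ℝ) × (Fin N → ℝ) =>
      F (Fin.cons ((A / a 0) • p.2 + headRow a p.1) p.1) := by
    have hh : Measurable fun p : (Fin k → Fin N → ℝ) × (Fin N → ℝ) =>
        (A / a 0) • p.2 + headRow a p.1 :=
      (measurable_snd.const_smul (A / a 0)).add ((measurable_headRow a).comp measurable_fst)
    exact hFm.comp (measurable_cons.comp (hh.prodMk measurable_fst))
  have h4 : ∀ s : Fin N → ℝ, ∫⁻ w' : Fin k → Fin N → ℝ,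
      F (Fin.cons ((A / a 0) • s + headRow a w') w') =
      ∫⁻ ζ : Fin k → Fin N → ℝ, F (fun μ => completeRows a ζ μ + a μ • s) := fun s => by
    rw [← lintegral_add_right_eq_self _ (fun μ : Fin k => a μ.succ • s)]
    refine lintegral_congr fun ζ => ?_
    congr 1
    rw [hAdef, headRow_add ha]
    funext μ
    refine Fin.cases ?_ (fun μ => ?_) μ <;> simp [completeRows]
  have h5 : ∀ (s : Fin N → ℝ) (ζ : Fin k → Fin N → ℝ),
      F (fun μ => completeRows a ζ μ + a μ • s) =
        ENNReal.ofReal (rexp (-(√A ^ 2 * dotp s s) / 2)) * (f (completeRows a ζ) *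
          gaussWeight ((k + 1) * N)
            (∑ μ, dotp (completeRows a ζ μ) (completeRows a ζ μ))) := fun s ζ => by
    simp only [hF]
    rw [projRows_completeRows_add ha, sum_dotp_completeRows_add ha, gaussWeight_add,
      Real.sq_sqrt hA.le]
    ring
  have hm6 : Measurable fun ζ : Fin k → Fin N → ℝ => f (completeRows a ζ) *
          gaussWeight ((k + 1) * N)
            (∑ μ, dotp (completeRows a ζ μ) (completeRows a ζ μ)) :=
    (hf.comp (measurable_completeRows a)).mul (hwm.comp (measurable_completeRows a))
  have hm7 : Measurable fun s : Fin N → ℝ =>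
      ENNReal.ofReal (rexp (-(√A ^ 2 * dotp s s) / 2)) := by
    have := measurable_dotp_self N
    fun_prop
  rw [h1, h2]
  simp_rw [h3]
  rw [lintegral_const_mul' _ _ ENNReal.ofReal_ne_top,
    lintegral_lintegral_swap hm4.aemeasurable]
  simp_rw [h4, h5, lintegral_const_mul _ hm6]
  rw [lintegral_mul_const _ hm7, lintegral_exp_scaled (Real.sqrt_pos.2 hA), ← mul_assoc,
    ← ENNReal.ofReal_mul (by positivity)]
  congr 2
  have hsA : √A ≠ 0 := (Real.sqrt_pos.2 hA).ne'
  rw [abs_div, abs_of_pos hA]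
  nth_rewrite 1 [← Real.mul_self_sqrt hA.le]
  have := abs_ne_zero.2 ha
  rw [div_pow, div_pow, mul_pow]
  field_simp

end Disintegration

section Chart

variable {E : Type*} [NormedAddCommGroup E] [InnerProductSpace ℝ E] {k : ℕ}

/-- The direction of a vector. -/
def dir (x : E) : E := ‖x‖⁻¹ • x

/-- The tangential sum `∑ ψ(⟪η_μ, d⟫) (η_μ - ⟪η_μ, d⟫ d)`. -/
def tangentSum (ψ : ℝ → ℝ) (η : Fin k → E) (d : E) : E :=
  ∑ μ, ψ (inner ℝ (η μ) d) • (η μ - inner ℝ (η μ) d • d)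

/-- The vector `ξ₀` with `⟪ξ₀, dir x⟫ = log ‖x‖` for which `dir x` is a critical point. -/
def chartRow (ψ : ℝ → ℝ) (η : Fin k → E) (x : E) : E :=
  log ‖x‖ • dir x - (ψ (log ‖x‖))⁻¹ • tangentSum ψ η (dir x)

/-- The chart parametrizing pairs of data and a critical point. -/
def chartMap (ψ : ℝ → ℝ) (p : E × (Fin k → E)) : E × (Fin k → E) :=
  (chartRow ψ p.2 p.1, p.2)

/-- The domain of `chartMap`. -/
def chartDomain (E : Type*) [NormedAddCommGroup E] (k : ℕ) (ψ : ℝ → ℝ) : Set (E × (Fin k → E)) :=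
  {p | p.1 ≠ 0 ∧ ψ (log ‖p.1‖) ≠ 0}

/-- The scalar products of the data with the critical point, read in the chart. -/
def chartLevels (p : E × (Fin k → E)) : Fin (k + 1) → ℝ :=
  Fin.cons (log ‖p.1‖) fun μ => inner ℝ (p.2 μ) (dir p.1)

/-- The part of the chart where the levels belong to `S`. -/
def chartPart (E : Type*) [NormedAddCommGroup E] [InnerProductSpace ℝ E] (ψ : ℝ → ℝ)
    (S : Set (Fin (k + 1) → ℝ)) : Set (E × (Fin k → E)) :=
  {p | p ∈ chartDomain E k ψ ∧ chartLevels p ∈ S}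

lemma norm_dir {x : E} (hx : x ≠ 0) : ‖dir x‖ = 1 := by
  rw [dir, norm_smul, norm_inv, norm_norm, inv_mul_cancel₀ (norm_ne_zero_iff.2 hx)]

lemma norm_smul_dir (x : E) : ‖x‖ • dir x = x := by
  rcases eq_or_ne x 0 with rfl | hx
  · simp [dir]
  · rw [dir, smul_smul, mul_inv_cancel₀ (norm_ne_zero_iff.2 hx), one_smul]

lemma norm_exp_smul {u : E} (hu : ‖u‖ = 1) (y : ℝ) : ‖rexp y • u‖ = rexp y := by
  rw [norm_smul, hu, mul_one, Real.norm_eq_abs, Real.abs_exp]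

lemma dir_exp_smul {u : E} (hu : ‖u‖ = 1) (y : ℝ) : dir (rexp y • u) = u := by
  rw [dir, norm_exp_smul hu, smul_smul, inv_mul_cancel₀ (Real.exp_pos y).ne', one_smul]

lemma isOpen_chartDomain {F : Type*} [NormedAddCommGroup F] {ψ : ℝ → ℝ} (hψ : Continuous ψ) :
    IsOpen (chartDomain F k ψ) := by
  have h0 : IsOpen {p : F × (Fin k → F) | p.1 ≠ 0} :=
    isOpen_ne_fun continuous_fst continuous_const
  have hc : ContinuousOn (fun p : F × (Fin k → F) => ψ (log ‖p.1‖)) {p | p.1 ≠ 0} :=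
    hψ.comp_continuousOn ((continuous_fst.norm.continuousOn).log
      fun p hp => norm_ne_zero_iff.2 hp)
  exact hc.isOpen_inter_preimage h0 isOpen_compl_singleton

lemma contDiffOn_chartMap {ψ : ℝ → ℝ} (hψ : ContDiff ℝ 1 ψ) :
    ContDiffOn ℝ 1 (chartMap (E := E) (k := k) ψ) (chartDomain E k ψ) := by
  have hn : ContDiffOn ℝ 1 (fun p : E × (Fin k → E) => ‖p.1‖) (chartDomain E k ψ) :=
    contDiff_fst.contDiffOn.norm ℝ fun p hp => hp.1
  have hl : ContDiffOn ℝ 1 (fun p : E × (Fin k → E) => log ‖p.1‖) (chartDomain E k ψ) :=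
    hn.log fun p hp => norm_ne_zero_iff.2 hp.1
  have hd : ContDiffOn ℝ 1 (fun p : E × (Fin k → E) => dir p.1) (chartDomain E k ψ) :=
    (hn.inv fun p hp => norm_ne_zero_iff.2 hp.1).smul contDiff_fst.contDiffOn
  have hη : ∀ μ, ContDiffOn ℝ 1 (fun p : E × (Fin k → E) => p.2 μ) (chartDomain E k ψ) :=
    fun μ => ((contDiff_apply ℝ E μ).comp contDiff_snd).contDiffOn
  have hi : ∀ μ, ContDiffOn ℝ 1 (fun p : E × (Fin k → E) => inner ℝ (p.2 μ) (dir p.1))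
      (chartDomain E k ψ) := fun μ => (hη μ).inner ℝ hd
  refine ContDiffOn.prodMk ?_ contDiff_snd.contDiffOn
  refine (hl.smul hd).sub (((hψ.comp_contDiffOn hl).inv fun p hp => hp.2).smul ?_)
  exact ContDiffOn.sum fun μ _ =>
    (hψ.comp_contDiffOn (hi μ)).smul ((hη μ).sub ((hi μ).smul hd))

lemma inner_tangentSum (ψ : ℝ → ℝ) (η : Fin k → E) {d : E} (hd : ‖d‖ = 1) :
    inner ℝ (tangentSum ψ η d) d = 0 := by
  rw [tangentSum, sum_inner]
  refine Finset.sum_eq_zero fun μ _ => ?_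
  rw [inner_smul_left, inner_sub_left, inner_smul_left, real_inner_self_eq_norm_sq, hd]
  simp

lemma inner_chartRow (ψ : ℝ → ℝ) (η : Fin k → E) {x : E} (hx : x ≠ 0) :
    inner ℝ (chartRow ψ η x) (dir x) = log ‖x‖ := by
  rw [chartRow, inner_sub_left, inner_smul_left, inner_smul_left, real_inner_self_eq_norm_sq,
    norm_dir hx, inner_tangentSum ψ η (norm_dir hx)]
  simp

/-- Unit vectors at which the tangential gradient vanishes, with nonvanishing first coefficient
and levels in `S`. -/
def headCrit (ψ : ℝ → ℝ) (S : Set (Fin (k + 1) → ℝ)) (q : E × (Fin k → E)) : Set E :=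
  {x | ‖x‖ = 1 ∧ ψ (inner ℝ q.1 x) • (q.1 - inner ℝ q.1 x • x) + tangentSum ψ q.2 x = 0 ∧
    ψ (inner ℝ q.1 x) ≠ 0 ∧
    (Fin.cons (inner ℝ q.1 x) fun μ => inner ℝ (q.2 μ) x : Fin (k + 1) → ℝ) ∈ S}

lemma encard_headCrit (ψ : ℝ → ℝ) (S : Set (Fin (k + 1) → ℝ)) (q : E × (Fin k → E)) :
    (headCrit ψ S q).encard = (chartPart E ψ S ∩ chartMap ψ ⁻¹' {q}).encard := by
  have hinj : InjOn (fun x => (rexp (inner ℝ q.1 x) • x, q.2)) (headCrit ψ S q) := by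
    intro x hx x' hx' h
    have h1 : rexp (inner ℝ q.1 x) • x = rexp (inner ℝ q.1 x') • x' := congrArg Prod.fst h
    rw [← dir_exp_smul hx.1 (inner ℝ q.1 x), h1, dir_exp_smul hx'.1]
  rw [← hinj.encard_image]
  congr 1
  ext p
  constructor
  · rintro ⟨x, ⟨hx, hcrit, hne, hS⟩, rfl⟩
    have hlog : log ‖rexp (inner ℝ q.1 x) • x‖ = inner ℝ q.1 x := by
      rw [norm_exp_smul hx, Real.log_exp]
    have hdir : dir (rexp (inner ℝ q.1 x) • x) = x := dir_exp_smul hx _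
    refine ⟨⟨⟨?_, ?_⟩, ?_⟩, ?_⟩
    · rw [← norm_ne_zero_iff, norm_exp_smul hx]
      exact (Real.exp_pos _).ne'
    · simpa only [hlog] using hne
    · simpa only [chartLevels, hlog, hdir] using hS
    · refine Prod.ext ?_ rfl
      simp only [chartMap, chartRow, hlog, hdir]
      rw [← eq_neg_iff_add_eq_zero] at hcrit
      rw [← neg_eq_iff_eq_neg.2 hcrit, smul_neg, smul_smul, inv_mul_cancel₀ hne, one_smul]
      abel
  · rintro ⟨⟨⟨hp0, hne⟩, hS⟩, hq : chartMap ψ p = q⟩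
    have hq1 : chartRow ψ p.2 p.1 = q.1 := congrArg Prod.fst hq
    have hq2 : (chartMap ψ p).2 = q.2 := congrArg Prod.snd hq
    replace hq2 : p.2 = q.2 := hq2
    have hin : inner ℝ q.1 (dir p.1) = log ‖p.1‖ := by rw [← hq1, inner_chartRow ψ p.2 hp0]
    refine ⟨dir p.1, ⟨norm_dir hp0, ?_, ?_, ?_⟩, ?_⟩
    · rw [hin, ← hq2, ← hq1, chartRow, sub_right_comm, sub_self, zero_sub, smul_neg, smul_smul,
        mul_inv_cancel₀ hne, one_smul, neg_add_cancel]
    · rwa [hin]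
    · simpa only [chartLevels, hin, ← hq2] using hS
    · refine Prod.ext ?_ hq2.symm
      simp only [hin]
      rw [Real.exp_log (norm_pos_iff.2 hp0), norm_smul_dir]

section Det

/-- A linear map of a product acting as the identity modulo the first factor. -/
lemma det_eq_det_of_snd {E F : Type*} [AddCommGroup E] [Module ℝ E] [FiniteDimensional ℝ E]
    [AddCommGroup F] [Module ℝ F] [FiniteDimensional ℝ F] (D : E × F →ₗ[ℝ] E × F) (A : E →ₗ[ℝ] E)
    (hsnd : ∀ v, (D v).2 = v.2) (hfst : ∀ v, (D (v, 0)).1 = A v) :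
    LinearMap.det D = LinearMap.det A := by
  classical
  let b := Module.finBasis ℝ E
  let b' := Module.finBasis ℝ F
  rw [← LinearMap.det_toMatrix (b.prod b'), ← LinearMap.det_toMatrix b,
    ← Matrix.fromBlocks_toBlocks (LinearMap.toMatrix (b.prod b') (b.prod b') D)]
  have h21 : (LinearMap.toMatrix (b.prod b') (b.prod b') D).toBlocks₂₁ = 0 := by
    ext i j
    simp [Matrix.toBlocks₂₁, LinearMap.toMatrix_apply, hsnd]
  have h22 : (LinearMap.toMatrix (b.prod b') (b.prod b') D).toBlocks₂₂ = 1 := by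
    ext i j
    simp [Matrix.toBlocks₂₂, LinearMap.toMatrix_apply, hsnd, Matrix.one_apply,
      Finsupp.single_apply, eq_comm]
  have h11 : (LinearMap.toMatrix (b.prod b') (b.prod b') D).toBlocks₁₁ =
      LinearMap.toMatrix b b A := by
    ext i j
    simp [Matrix.toBlocks₁₁, LinearMap.toMatrix_apply, hfst]
  rw [h21, h22, h11, Matrix.det_fromBlocks_zero₂₁, Matrix.det_one, mul_one]

variable [FiniteDimensional ℝ E]

lemma det_fderiv_chartMap {ψ : ℝ → ℝ} (hψ : ContDiff ℝ 1 ψ) {p : E × (Fin k → E)}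
    (hp : p ∈ chartDomain E k ψ) :
    (fderiv ℝ (chartMap ψ) p).det = (fderiv ℝ (chartRow ψ p.2) p.1).det := by
  have hT : HasFDerivAt (chartMap ψ) (fderiv ℝ (chartMap ψ) p) p :=
    (((contDiffOn_chartMap hψ).contDiffAt ((isOpen_chartDomain hψ.continuous).mem_nhds
      hp)).differentiableAt one_ne_zero).hasFDerivAt
  set D := fderiv ℝ (chartMap ψ) p with hD
  have hsnd : ∀ v, (D v).2 = v.2 := fun v => by
    have h1 : HasFDerivAt (fun q => (chartMap (E := E) (k := k) ψ q).2)
        ((ContinuousLinearMap.snd ℝ _ _).comp D) p := hT.snd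
    have h2 : HasFDerivAt (fun q => (chartMap (E := E) (k := k) ψ q).2)
        (ContinuousLinearMap.snd ℝ E (Fin k → E)) p := hasFDerivAt_snd
    exact congrArg (fun L : E × (Fin k → E) →L[ℝ] (Fin k → E) => L v) (h1.unique h2)
  have hfst : ∀ v, (D (v, 0)).1 = fderiv ℝ (chartRow ψ p.2) p.1 v := fun v => by
    have h1 : HasFDerivAt (fun x => (chartMap ψ (x, p.2)).1)
        (((ContinuousLinearMap.fst ℝ _ _).comp D).comp
          (ContinuousLinearMap.inl ℝ E (Fin k → E))) p.1 :=
      HasFDerivAt.comp (g := fun q => (chartMap ψ q).1) p.1 hT.fst (hasFDerivAt_prodMk_left p.1 p.2)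
    have h2 : fderiv ℝ (chartRow ψ p.2) p.1 = _ := h1.fderiv
    rw [h2]
    rfl
  exact det_eq_det_of_snd (D : E × (Fin k → E) →ₗ[ℝ] E × (Fin k → E)) _ hsnd hfst

end Det

end Chart

section Jacobian

variable {E : Type*} [NormedAddCommGroup E] [InnerProductSpace ℝ E] {k : ℕ}

lemma dir_eq_exp_smul (x : E) : dir x = rexp (-log ‖x‖) • x := by
  rcases eq_or_ne x 0 with rfl | hx
  · simp [dir]
  · rw [dir, Real.exp_neg, Real.exp_log (norm_pos_iff.2 hx)]

lemma hasDerivAt_log_norm_line {u : E} (hu : ‖u‖ = 1) (y : ℝ) (h : E) :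
    HasDerivAt (fun t : ℝ => log ‖rexp y • u + t • (rexp y • h)‖) (inner ℝ u h) 0 := by
  have hc : HasDerivAt (fun t : ℝ => rexp y • u + t • (rexp y • h)) (rexp y • h) 0 := by
    simpa using ((hasDerivAt_id (0 : ℝ)).smul_const (rexp y • h)).const_add (rexp y • u)
  have h1 := hc.norm_sq
  have hne : ‖rexp y • u + (0 : ℝ) • (rexp y • h)‖ ^ 2 ≠ 0 := by
    rw [zero_smul, add_zero, norm_exp_smul hu]
    positivity
  have h2 := (h1.log hne).const_mul (1 / 2 : ℝ)
  refine (h2.congr_deriv ?_).congr_of_eventuallyEq (.of_forall fun t => ?_)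
  rotate_left
  · simp only [Real.log_pow]
    push_cast
    ring
  · rw [zero_smul, add_zero, norm_exp_smul hu, inner_smul_left, inner_smul_right]
    have := (Real.exp_pos y).ne'
    simp only [conj_trivial]
    field_simp

lemma hasDerivAt_dir_line {u : E} (hu : ‖u‖ = 1) (y : ℝ) (h : E) :
    HasDerivAt (fun t : ℝ => dir (rexp y • u + t • (rexp y • h))) (h - inner ℝ u h • u) 0 := by
  have hc : HasDerivAt (fun t : ℝ => rexp y • u + t • (rexp y • h)) (rexp y • h) 0 := by
    simpa using ((hasDerivAt_id (0 : ℝ)).smul_const (rexp y • h)).const_add (rexp y • u)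
  have h1 := ((hasDerivAt_log_norm_line hu y h).neg.exp).smul hc
  simp only [dir_eq_exp_smul]
  refine h1.congr_deriv ?_
  simp only [Pi.neg_apply]
  rw [zero_smul, add_zero, norm_exp_smul hu, Real.log_exp, smul_smul, ← Real.exp_add,
    neg_add_cancel, Real.exp_zero, one_smul, smul_smul, mul_right_comm, ← Real.exp_add,
    neg_add_cancel, Real.exp_zero, one_mul, neg_smul, sub_eq_add_neg]

lemma fderiv_chartRow_apply [FiniteDimensional ℝ E] {ψ : ℝ → ℝ} (hψ : ContDiff ℝ 1 ψ)
    (η : Fin k → E) {u : E} (hu : ‖u‖ = 1) {y : ℝ} (hy : ψ y ≠ 0) (h : E) :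
    fderiv ℝ (chartRow ψ η) (rexp y • u) (rexp y • h) =
      y • (h - inner ℝ u h • u) + inner ℝ u h • u -
        ((ψ y)⁻¹ • ∑ μ, (ψ (inner ℝ (η μ) u) • -(inner ℝ (η μ) u • (h - inner ℝ u h • u) +
              inner ℝ (η μ) (h - inner ℝ u h • u) • u) +
            (deriv ψ (inner ℝ (η μ) u) * inner ℝ (η μ) (h - inner ℝ u h • u)) •
              (η μ - inner ℝ (η μ) u • u)) +
          (-(deriv ψ y * inner ℝ u h) / ψ y ^ 2) • tangentSum ψ η u) := by
  have hmem : (rexp y • u, η) ∈ chartDomain E k ψ := by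
    refine ⟨?_, ?_⟩
    · exact norm_ne_zero_iff.1 (by rw [norm_exp_smul hu]; exact (Real.exp_pos y).ne')
    · simpa only [norm_exp_smul hu, Real.log_exp] using hy
  have hd : DifferentiableAt ℝ (chartRow ψ η) (rexp y • u) := by
    have h1 := ((contDiffOn_chartMap hψ).contDiffAt ((isOpen_chartDomain hψ.continuous).mem_nhds
      hmem)).differentiableAt one_ne_zero
    have h2 : DifferentiableAt ℝ (fun x : E => (x, η)) (rexp y • u) :=
      (hasFDerivAt_prodMk_left (rexp y • u) η).differentiableAt
    exact DifferentiableAt.comp (g := fun q => (chartMap ψ q).1) (rexp y • u) h1.fst h2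
  set c : ℝ → E := fun t => rexp y • u + t • (rexp y • h) with hcdef
  have hc : HasDerivAt c (rexp y • h) 0 := by
    rw [hcdef]
    simpa using ((hasDerivAt_id (0 : ℝ)).smul_const (rexp y • h)).const_add (rexp y • u)
  have hc0 : c 0 = rexp y • u := by simp [c]
  have h1 : HasDerivAt (fun t => chartRow ψ η (c t))
      (fderiv ℝ (chartRow ψ η) (rexp y • u) (rexp y • h)) 0 := by
    have : HasFDerivAt (chartRow ψ η) (fderiv ℝ (chartRow ψ η) (rexp y • u)) (c 0) := by
      rw [hc0]; exact hd.hasFDerivAt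
    exact this.comp_hasDerivAt 0 hc
  have hL := hasDerivAt_log_norm_line hu y h
  have hD := hasDerivAt_dir_line hu y h
  have hL0 : log ‖rexp y • u + (0 : ℝ) • (rexp y • h)‖ = y := by
    rw [zero_smul, add_zero, norm_exp_smul hu, Real.log_exp]
  have hD0 : dir (rexp y • u + (0 : ℝ) • (rexp y • h)) = u := by
    rw [zero_smul, add_zero, dir_exp_smul hu]
  have hψd : ∀ s, HasDerivAt ψ (deriv ψ s) s := fun s =>
    (hψ.differentiable one_ne_zero s).hasDerivAt
  have hg : ∀ μ, HasDerivAt (fun t : ℝ => inner ℝ (η μ) (dir (c t)))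
      (inner ℝ (η μ) (h - inner ℝ u h • u)) 0 := fun μ => by
    simpa using (hasDerivAt_const (0 : ℝ) (η μ)).inner ℝ hD
  have hψg : ∀ μ, HasDerivAt (fun t : ℝ => ψ (inner ℝ (η μ) (dir (c t))))
      (deriv ψ (inner ℝ (η μ) u) * inner ℝ (η μ) (h - inner ℝ u h • u)) 0 := fun μ => by
    have := (hψd (inner ℝ (η μ) (dir (c 0)))).comp 0 (hg μ)
    rwa [hc0, dir_exp_smul hu] at this
  have hψL : HasDerivAt (fun t : ℝ => ψ (log ‖c t‖)) (deriv ψ y * inner ℝ u h) 0 := by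
    have := (hψd (log ‖c 0‖)).comp 0 hL
    rwa [show log ‖c 0‖ = y from hL0] at this
  have hsum := HasDerivAt.fun_sum (u := Finset.univ) fun μ _ =>
    (hψg μ).smul (((hasDerivAt_const (0 : ℝ) (η μ))).sub ((hg μ).smul hD))
  have h2 := (hL.smul hD).sub ((hψL.inv (by rwa [show log ‖c 0‖ = y from hL0])).smul hsum)
  have h3 := h1.unique h2
  rw [h3]
  simp only [Pi.sub_apply, Pi.smul_apply', c, hL0, hD0, zero_sub, Pi.inv_apply, tangentSum]

end Jacobian

section JacobianDet

variable {k N : ℕ}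

/-- Schur complement of a unit corner entry. -/
lemma det_of_corner_one (M : Matrix (Fin (N + 1)) (Fin (N + 1)) ℝ) (h : M 0 0 = 1) :
    M.det = (Matrix.of fun i j : Fin N => M i.succ j.succ - M i.succ 0 * M 0 j.succ).det := by
  set c : Fin (N + 1) → ℝ := Fin.cons 0 fun i => M i.succ 0 with hc
  have h1 : M.det = (Matrix.of fun i j => M i j - c i * M 0 j).det := by
    refine Matrix.det_eq_of_forall_row_eq_smul_add_const c 0 (by simp [hc]) fun i j => ?_
    simp [hc]
  rw [h1, Matrix.det_succ_column_zero, Fin.sum_univ_succ]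
  have h2 : ∀ i : Fin N, M i.succ 0 - c i.succ * M 0 0 = 0 := fun i => by simp [hc, h]
  simp only [Matrix.of_apply, h2]
  simp [hc, h, Matrix.submatrix]

/-- The matrix `∑ ψ'(y_μ) Z_μ Z_μᵀ - (∑ ψ(y_μ) y_μ) I`. -/
def critMat (ψ : ℝ → ℝ) (y : Fin (k + 1) → ℝ) (Z : Fin (k + 1) → Fin N → ℝ) :
    Matrix (Fin N) (Fin N) ℝ :=
  Matrix.of fun i j => (∑ μ, deriv ψ (y μ) * Z μ i * Z μ j) -
    if i = j then ∑ μ, ψ (y μ) * y μ else 0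

/-- The vector of `ℝ^{N+1}` with the given head and tail. -/
def consVec (y : ℝ) (ζ : Fin N → ℝ) : EuclideanSpace ℝ (Fin (N + 1)) :=
  WithLp.toLp 2 (Fin.cons y ζ)

/-- The first basis vector. -/
def headVec (N : ℕ) : EuclideanSpace ℝ (Fin (N + 1)) := EuclideanSpace.single 0 1

lemma norm_headVec : ‖headVec N‖ = 1 := by simp [headVec]

lemma inner_consVec_headVec (y : ℝ) (ζ : Fin N → ℝ) : inner ℝ (consVec y ζ) (headVec N) = y := by
  simp [consVec, headVec, EuclideanSpace.inner_single_right]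

lemma abs_det_fderiv_chartRow {ψ : ℝ → ℝ} (hψ : ContDiff ℝ 1 ψ) (y : Fin (k + 1) → ℝ)
    (hy : ψ (y 0) ≠ 0) (ζ : Fin k → Fin N → ℝ) :
    |(fderiv ℝ (chartRow ψ fun μ => consVec (y μ.succ) (ζ μ)) (rexp (y 0) • headVec N)).det| =
      rexp (-((N + 1 : ℕ) * y 0)) * (|ψ (y 0)|⁻¹ ^ N *
        |(critMat ψ y (completeRows (fun μ => ψ (y μ)) ζ)).det|) := by
  set η : Fin k → EuclideanSpace ℝ (Fin (N + 1)) := fun μ => consVec (y μ.succ) (ζ μ) with hη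
  set D := fderiv ℝ (chartRow ψ η) (rexp (y 0) • headVec N) with hD
  set b := (EuclideanSpace.basisFun (Fin (N + 1)) ℝ).toBasis with hb
  set M := LinearMap.toMatrix b b (rexp (y 0) • (D : EuclideanSpace ℝ (Fin (N + 1)) →ₗ[ℝ] _))
    with hM
  have hdet : M.det = rexp (y 0) ^ (N + 1) * D.det := by
    rw [hM, LinearMap.det_toMatrix, LinearMap.det_smul]
    simp [ContinuousLinearMap.det]
  have hentry : ∀ i j, M i j = (D (rexp (y 0) • EuclideanSpace.single j 1)) i := fun i j => by
    rw [hM, LinearMap.toMatrix_apply]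
    simp [hb]
  have hin : ∀ μ, inner ℝ (η μ) (headVec N) = y μ.succ := fun μ => inner_consVec_headVec _ _
  have hD' := fun h => fderiv_chartRow_apply hψ η (norm_headVec (N := N)) hy h
  simp only [← hD, hin, tangentSum] at hD'
  have hi0 : inner ℝ (headVec N) (EuclideanSpace.single 0 1) = 1 := by simp [headVec]
  have hij : ∀ j : Fin N, inner ℝ (headVec N) (EuclideanSpace.single j.succ 1) = 0 := fun j => by
    simp [headVec, EuclideanSpace.inner_single_right]
  have hη1 : ∀ μ (j : Fin N), inner ℝ (η μ) (EuclideanSpace.single j.succ 1) = ζ μ j :=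
    fun μ j => by simp [hη, consVec, EuclideanSpace.inner_single_right]
  have hη0 : ∀ μ, (η μ) 0 = y μ.succ := fun μ => by simp [hη, consVec]
  have hηs : ∀ μ (i : Fin N), (η μ) i.succ = ζ μ i := fun μ i => by simp [hη, consVec]
  have he0 : (headVec N) 0 = 1 := by simp [headVec]
  have hes : ∀ i : Fin N, (headVec N) i.succ = 0 := fun i => by simp [headVec]
  have h00 : M 0 0 = 1 := by
    rw [hentry, hD', hi0]
    simp [headVec, hη0]
  have h0s : ∀ j : Fin N, M 0 j.succ = (ψ (y 0))⁻¹ * ∑ μ, ψ (y μ.succ) * ζ μ j := fun j => by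
    rw [hentry, hD', hij]
    simp [headVec, hη0, hη1]
  have hs0 : ∀ i : Fin N, M i.succ 0 =
      deriv ψ (y 0) / ψ (y 0) ^ 2 * ∑ μ, ψ (y μ.succ) * ζ μ i := fun i => by
    rw [hentry, hD', hi0]
    simp [headVec, hηs, neg_div]
  have hss : ∀ i j : Fin N, M i.succ j.succ = (if i = j then y 0 else 0) -
      (ψ (y 0))⁻¹ * ∑ μ, (deriv ψ (y μ.succ) * ζ μ j * ζ μ i -
        ψ (y μ.succ) * (y μ.succ * if i = j then 1 else 0)) := fun i j => by
    rw [hentry, hD', hij]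
    have hp : (Pi.single j.succ 1 : Fin (N + 1) → ℝ) i.succ = if i = j then 1 else 0 := by
      simp [Pi.single_apply]
    have hsm : (if i = j then y 0 else 0) = y 0 * if i = j then 1 else 0 := by simp
    simp only [headVec, zero_smul, sub_zero, hη1, smul_add, smul_neg, add_zero, smul_sub, mul_zero,
      neg_zero, zero_div, PiLp.sub_apply, PiLp.smul_apply, PiLp.neg_apply, PiLp.add_apply, hηs,
      smul_eq_mul, WithLp.ofLp_sum, Finset.sum_apply, PiLp.single_apply, Fin.succ_inj,
      Fin.succ_ne_zero, if_false, hsm]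
    congr 2
    refine Finset.sum_congr rfl fun μ _ => ?_
    ring
  have hschur : (Matrix.of fun i j : Fin N => M i.succ j.succ - M i.succ 0 * M 0 j.succ) =
      (-(ψ (y 0))⁻¹) • critMat ψ y (completeRows (fun μ => ψ (y μ)) ζ) := by
    ext i j
    have hh : ∀ i, headRow (fun μ => ψ (y μ)) ζ i =
        -((ψ (y 0))⁻¹ * ∑ μ, ψ (y μ.succ) * ζ μ i) := fun i => by
      simp [headRow]
    simp only [Matrix.of_apply, Matrix.smul_apply, critMat, smul_eq_mul, h0s, hs0, hss,
      Fin.sum_univ_succ, completeRows, Fin.cons_zero, Fin.cons_succ, hh]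
    have hs : ∑ μ : Fin k, (deriv ψ (y μ.succ) * ζ μ j * ζ μ i -
        ψ (y μ.succ) * (y μ.succ * if i = j then 1 else 0)) =
        (∑ μ : Fin k, deriv ψ (y μ.succ) * ζ μ i * ζ μ j) -
          (∑ μ : Fin k, ψ (y μ.succ) * y μ.succ) * if i = j then 1 else 0 := by
      rw [Finset.sum_sub_distrib, Finset.sum_mul]
      congr 1 <;> exact Finset.sum_congr rfl fun _ _ => by ring
    rw [hs]
    generalize ∑ μ : Fin k, deriv ψ (y μ.succ) * ζ μ i * ζ μ j = s₁
    generalize ∑ μ : Fin k, ψ (y μ.succ) * y μ.succ = s₂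
    split_ifs <;> field_simp <;> ring
  have hMdet := det_of_corner_one M h00
  rw [hschur, Matrix.det_smul, Fintype.card_fin, hdet] at hMdet
  have hexp : rexp (y 0) ^ (N + 1) = rexp ((N + 1 : ℕ) * y 0) := by rw [← Real.exp_nat_mul]
  have habs := congrArg abs hMdet
  rw [hexp, abs_mul, Real.abs_exp, abs_mul, abs_pow, abs_neg, abs_inv] at habs
  rw [Real.exp_neg, ← habs, ← mul_assoc, inv_mul_cancel₀ (Real.exp_pos _).ne', one_mul]

end JacobianDet

section Rotation

variable {E : Type*} [NormedAddCommGroup E] [InnerProductSpace ℝ E] {k : ℕ}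

/-- The Gaussian weight of the data, in dimension `d`. -/
def dataWeight {F : Type*} [NormedAddCommGroup F] (d : ℕ) (q : F × (Fin k → F)) : ℝ≥0∞ :=
  gaussWeight d (‖q.1‖ ^ 2 + ∑ μ, ‖q.2 μ‖ ^ 2)

/-- The integrand of the area formula for `chartMap`. -/
def chartDensity (d : ℕ) (ψ : ℝ → ℝ) (S : Set (Fin (k + 1) → ℝ)) (x : E) (η : Fin k → E) :
    ℝ≥0∞ :=
  if (x, η) ∈ chartPart E ψ S then
    ENNReal.ofReal |(fderiv ℝ (chartRow ψ η) x).det| * dataWeight d (chartRow ψ η x, η)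
  else 0

variable (R : E ≃ₗᵢ[ℝ] E)

lemma dir_map (x : E) : dir (R x) = R (dir x) := by simp [dir]

lemma chartRow_map (ψ : ℝ → ℝ) (η : Fin k → E) (x : E) :
    chartRow ψ (fun μ => R (η μ)) (R x) = R (chartRow ψ η x) := by
  simp [chartRow, tangentSum, dir_map]

lemma mem_chartPart_map (ψ : ℝ → ℝ) (S : Set (Fin (k + 1) → ℝ)) (η : Fin k → E) (x : E) :
    (R x, fun μ => R (η μ)) ∈ chartPart E ψ S ↔ (x, η) ∈ chartPart E ψ S := by
  simp [chartPart, chartDomain, chartLevels, dir_map]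

lemma chartDensity_map [FiniteDimensional ℝ E] (d : ℕ) (ψ : ℝ → ℝ) (S : Set (Fin (k + 1) → ℝ))
    (x : E) (η : Fin k → E) :
    chartDensity d ψ S (R x) (fun μ => R (η μ)) = chartDensity d ψ S x η := by
  have hdet : (fderiv ℝ (chartRow ψ fun μ => R (η μ)) (R x)).det =
      (fderiv ℝ (chartRow ψ η) x).det := by
    have h1 : chartRow ψ (fun μ => R (η μ)) = (R ∘ chartRow ψ η) ∘ R.symm := by
      funext z
      have := chartRow_map R ψ η (R.symm z)
      simpa using this
    have h2 : fderiv ℝ ((R ∘ chartRow ψ η) ∘ R.symm) (R x) =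
        (R.toContinuousLinearEquiv : E →L[ℝ] E).comp ((fderiv ℝ (chartRow ψ η) x).comp
          (R.symm.toContinuousLinearEquiv : E →L[ℝ] E)) := by
      have h3 := R.symm.toContinuousLinearEquiv.comp_right_fderiv (f := R ∘ chartRow ψ η) (x := R x)
      have h4 := R.toContinuousLinearEquiv.comp_fderiv (f := chartRow ψ η) (x := x)
      have h5 : R.symm.toContinuousLinearEquiv (R x) = x := by simp
      rw [h5] at h3
      refine h3.trans ?_
      rw [← ContinuousLinearMap.comp_assoc, ← h4]
      rfl
    rw [h1, h2]
    exact LinearMap.det_conj (fderiv ℝ (chartRow ψ η) x : E →ₗ[ℝ] E)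
      R.toLinearEquiv
  simp only [chartDensity, mem_chartPart_map, chartRow_map, hdet, dataWeight,
    LinearIsometryEquiv.norm_map]

lemma chartDensity_eq_indicator [FiniteDimensional ℝ E] (d : ℕ) {ψ : ℝ → ℝ} (hψ : ContDiff ℝ 1 ψ)
    (S : Set (Fin (k + 1) → ℝ)) (p : E × (Fin k → E)) :
    chartDensity d ψ S p.1 p.2 = (chartPart E ψ S).indicator (fun p =>
      ENNReal.ofReal |(fderiv ℝ (chartMap ψ) p).det| * dataWeight d (chartMap ψ p)) p := by
  by_cases hp : p ∈ chartPart E ψ S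
  · rw [indicator_of_mem hp, chartDensity, if_pos hp, det_fderiv_chartMap hψ hp.1]
    rfl
  · rw [indicator_of_notMem hp, chartDensity, if_neg hp]

lemma exists_map_eq_norm_smul {u : E} (hu : ‖u‖ = 1) (x : E) :
    ∃ R : E ≃ₗᵢ[ℝ] E, R x = ‖x‖ • u := by
  refine ⟨(ℝ ∙ (x - ‖x‖ • u))ᗮ.reflection, ?_⟩
  exact Submodule.reflection_sub (by rw [norm_smul, hu]; simp)

end Rotation

section AreaIntegral

lemma measurable_dataWeight {F : Type*} [NormedAddCommGroup F] [MeasurableSpace F] [BorelSpace F]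
    [SecondCountableTopology F] (d : ℕ) {k : ℕ} :
    Measurable (dataWeight d : F × (Fin k → F) → ℝ≥0∞) := by
  have hη : ∀ μ, Measurable fun p : F × (Fin k → F) => p.2 μ :=
    fun μ => (measurable_pi_apply μ).comp measurable_snd
  refine (measurable_gaussWeight d).comp ?_
  fun_prop

variable {E : Type*} [NormedAddCommGroup E] [InnerProductSpace ℝ E] [FiniteDimensional ℝ E]
  [MeasurableSpace E] [BorelSpace E] {k : ℕ}

instance : (volume : Measure (E × (Fin k → E))).IsAddHaarMeasure :=
  Measure.prod.instIsAddHaarMeasure _ _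

lemma measurable_chartLevels : Measurable (chartLevels : E × (Fin k → E) → Fin (k + 1) → ℝ) := by
  have hd : Measurable fun p : E × (Fin k → E) => dir p.1 := by unfold dir; fun_prop
  refine measurable_cons.comp (.prodMk (measurable_norm.comp measurable_fst).log
    (measurable_pi_iff.2 fun μ => ?_))
  exact ((measurable_pi_apply μ).comp measurable_snd).inner hd

lemma measurable_chartMap {ψ : ℝ → ℝ} (hψ : Continuous ψ) :
    Measurable (chartMap ψ : E × (Fin k → E) → E × (Fin k → E)) := by
  have hd : Measurable fun p : E × (Fin k → E) => dir p.1 := by unfold dir; fun_prop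
  have hη : ∀ μ, Measurable fun p : E × (Fin k → E) => p.2 μ :=
    fun μ => (measurable_pi_apply μ).comp measurable_snd
  have hi : ∀ μ, Measurable fun p : E × (Fin k → E) => inner ℝ (p.2 μ) (dir p.1) :=
    fun μ => (hη μ).inner hd
  have hl : Measurable fun p : E × (Fin k → E) => log ‖p.1‖ :=
    (measurable_norm.comp measurable_fst).log
  refine .prodMk (.sub (hl.smul hd) (.smul (hψ.measurable.comp hl).inv ?_)) measurable_snd
  exact Finset.measurable_sum _ fun μ _ =>
    (hψ.measurable.comp (hi μ)).smul ((hη μ).sub ((hi μ).smul hd))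

lemma measurableSet_chartPart {ψ : ℝ → ℝ} (hψ : Continuous ψ) {S : Set (Fin (k + 1) → ℝ)}
    (hS : MeasurableSet S) : MeasurableSet (chartPart E ψ S) :=
  (isOpen_chartDomain hψ).measurableSet.inter (measurable_chartLevels hS)

lemma measurable_chartDensity (d : ℕ) {ψ : ℝ → ℝ} (hψ : ContDiff ℝ 1 ψ)
    {S : Set (Fin (k + 1) → ℝ)} (hS : MeasurableSet S) :
    Measurable fun p : E × (Fin k → E) => chartDensity d ψ S p.1 p.2 := by
  simp_rw [chartDensity_eq_indicator d hψ S]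
  refine Measurable.indicator ?_ (measurableSet_chartPart hψ.continuous hS)
  have h1 : Measurable fun p : E × (Fin k → E) => (fderiv ℝ (chartMap ψ) p).det :=
    ContinuousLinearMap.continuous_det.measurable.comp (measurable_fderiv ℝ _)
  exact (h1.norm.ennreal_ofReal).mul
    ((measurable_dataWeight d).comp (measurable_chartMap hψ.continuous))

lemma aemeasurable_encard_headCrit {ψ : ℝ → ℝ} (hψ : ContDiff ℝ 1 ψ)
    {S : Set (Fin (k + 1) → ℝ)} (hS : MeasurableSet S) :
    AEMeasurable (fun q : E × (Fin k → E) => ((headCrit ψ S q).encard : ℝ≥0∞)) := by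
  have h := (lintegral_encard_fiber (volume : Measure (E × (Fin k → E)))
    (isOpen_chartDomain hψ.continuous) (contDiffOn_chartMap hψ)
    (measurableSet_chartPart hψ.continuous hS) inter_subset_left
    (measurable_const (a := (1 : ℝ≥0∞)))).1
  simpa only [mul_one, ← encard_headCrit] using h

lemma lintegral_encard_headCrit (d : ℕ) {ψ : ℝ → ℝ} (hψ : ContDiff ℝ 1 ψ)
    {S : Set (Fin (k + 1) → ℝ)} (hS : MeasurableSet S) :
    ∫⁻ q : E × (Fin k → E), ((headCrit ψ S q).encard : ℝ≥0∞) * dataWeight d q =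
      ∫⁻ x : E, ∫⁻ η : Fin k → E, chartDensity d ψ S x η := by
  have h := (lintegral_encard_fiber (volume : Measure (E × (Fin k → E)))
    (isOpen_chartDomain hψ.continuous) (contDiffOn_chartMap hψ)
    (measurableSet_chartPart hψ.continuous hS) inter_subset_left (measurable_dataWeight d)).2
  simp only [← encard_headCrit] at h
  rw [h, ← lintegral_indicator (measurableSet_chartPart hψ.continuous hS)]
  simp_rw [← chartDensity_eq_indicator d hψ S]
  exact lintegral_prod _ (measurable_chartDensity d hψ hS).aemeasurable

lemma lintegral_chartDensity_radial (d : ℕ) {ψ : ℝ → ℝ} (hψ : ContDiff ℝ 1 ψ)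
    {S : Set (Fin (k + 1) → ℝ)} (hS : MeasurableSet S) {u : E} (hu : ‖u‖ = 1) :
    ∫⁻ x : E, ∫⁻ η : Fin k → E, chartDensity d ψ S x η =
      Module.finrank ℝ E * volume (Metric.ball (0 : E) 1) *
        ∫⁻ y : ℝ, ENNReal.ofReal (rexp (Module.finrank ℝ E * y)) *
          ∫⁻ η : Fin k → E, chartDensity d ψ S (rexp y • u) η := by
  have : Nontrivial E := ⟨u, 0, by rintro rfl; simp at hu⟩
  have hm : Measurable fun x : E => ∫⁻ η : Fin k → E, chartDensity d ψ S x η :=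
    (measurable_chartDensity d hψ hS).lintegral_prod_right'
  have hrot : ∀ x : E, ∫⁻ η : Fin k → E, chartDensity d ψ S x η =
      ∫⁻ η : Fin k → E, chartDensity d ψ S (‖x‖ • u) η := fun x => by
    obtain ⟨R, hR⟩ := exists_map_eq_norm_smul hu x
    have hmp : MeasurePreserving (fun (η : Fin k → E) μ => R (η μ)) volume volume :=
      volume_preserving_pi fun _ => R.measurePreserving
    have hmR : Measurable fun η : Fin k → E => chartDensity d ψ S (R x) η :=
      (measurable_chartDensity d hψ hS).comp measurable_prodMk_left
    rw [← hR, ← hmp.lintegral_comp hmR]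
    simp_rw [chartDensity_map]
  rw [lintegral_congr hrot]
  exact lintegral_fun_norm_addHaar volume (f := fun r => ∫⁻ η : Fin k → E,
    chartDensity d ψ S (r • u) η) (hm.comp (measurable_id.smul_const u))

end AreaIntegral

section Coordinates

variable {k N : ℕ}

lemma measurePreserving_consVec :
    MeasurePreserving (fun p : ℝ × (Fin N → ℝ) => consVec p.1 p.2) volume volume := by
  have h1 := (measurePreserving_piFinSuccAbove (fun _ : Fin (N + 1) => (volume : Measure ℝ)) 0).symm
  have h2 := PiLp.volume_preserving_toLp (Fin (N + 1))
  have h3 : (fun p : ℝ × (Fin N → ℝ) => consVec p.1 p.2) =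
      WithLp.toLp 2 ∘ (MeasurableEquiv.piFinSuccAbove (fun _ : Fin (N + 1) => ℝ) 0).symm := by
    funext p
    simp [consVec, MeasurableEquiv.piFinSuccAbove, Fin.insertNthEquiv]
  rw [h3]
  exact h2.comp h1

lemma lintegral_consVec_pi {f : (Fin k → EuclideanSpace ℝ (Fin (N + 1))) → ℝ≥0∞}
    (hf : Measurable f) :
    ∫⁻ η, f η = ∫⁻ y : Fin k → ℝ, ∫⁻ ζ : Fin k → Fin N → ℝ,
      f fun μ => consVec (y μ) (ζ μ) := by
  have h1 : MeasurePreserving (fun (p : Fin k → ℝ × (Fin N → ℝ)) μ => consVec (p μ).1 (p μ).2)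
      volume volume := volume_preserving_pi fun _ => measurePreserving_consVec
  have h2 := (volume_measurePreserving_arrowProdEquivProdArrow ℝ (Fin N → ℝ) (Fin k)).symm
  have h3 := h1.comp h2
  rw [← h3.lintegral_comp hf]
  exact lintegral_prod _ (hf.comp h3.measurable).aemeasurable

lemma norm_consVec_sq (y : ℝ) (ζ : Fin N → ℝ) : ‖consVec y ζ‖ ^ 2 = y ^ 2 + dotp ζ ζ := by
  rw [EuclideanSpace.norm_sq_eq, Fin.sum_univ_succ]
  simp [consVec, dotp, sq]

lemma chartRow_consVec (ψ : ℝ → ℝ) (y : Fin (k + 1) → ℝ) (ζ : Fin k → Fin N → ℝ) :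
    chartRow ψ (fun μ => consVec (y μ.succ) (ζ μ)) (rexp (y 0) • headVec N) =
      consVec (y 0) (headRow (fun μ => ψ (y μ)) ζ) := by
  rw [chartRow, norm_exp_smul norm_headVec, dir_exp_smul norm_headVec, Real.log_exp, tangentSum]
  simp_rw [inner_consVec_headVec]
  ext i
  refine Fin.cases ?_ (fun i => ?_) i <;> simp [consVec, headVec, headRow]

lemma dataWeight_consVec (y : Fin (k + 1) → ℝ) (Z : Fin (k + 1) → Fin N → ℝ) :
    dataWeight ((k + 1) * (N + 1))
        (consVec (y 0) (Z 0), fun μ : Fin k => consVec (y μ.succ) (Z μ.succ)) =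
      gaussWeight (k + 1) (dotp y y) * gaussWeight ((k + 1) * N) (∑ μ, dotp (Z μ) (Z μ)) := by
  rw [gaussWeight_mul, dataWeight]
  simp only [norm_consVec_sq, Finset.sum_add_distrib]
  congr 1
  · ring
  · rw [Fin.sum_univ_succ (fun μ => dotp (Z μ) (Z μ)), dotp.eq_def y y, Fin.sum_univ_succ]
    simp only [sq]
    ring

lemma chartDensity_consVec {ψ : ℝ → ℝ} (hψ : ContDiff ℝ 1 ψ) (S : Set (Fin (k + 1) → ℝ))
    (y : Fin (k + 1) → ℝ) (ζ : Fin k → Fin N → ℝ) :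
    ENNReal.ofReal (rexp ((N + 1 : ℕ) * y 0)) *
      chartDensity ((k + 1) * (N + 1)) ψ S (rexp (y 0) • headVec N)
        (fun μ => consVec (y μ.succ) (ζ μ)) =
      if ψ (y 0) ≠ 0 ∧ y ∈ S then
        gaussWeight (k + 1) (dotp y y) * (ENNReal.ofReal (|ψ (y 0)|⁻¹ ^ N) *
          (ENNReal.ofReal |(critMat ψ y (completeRows (fun μ => ψ (y μ)) ζ)).det| *
          gaussWeight ((k + 1) * N) (∑ μ, dotp (completeRows (fun μ => ψ (y μ)) ζ μ)
            (completeRows (fun μ => ψ (y μ)) ζ μ))))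
      else 0 := by
  have hlev :
      chartLevels (rexp (y 0) • headVec N, fun μ : Fin k => consVec (y μ.succ) (ζ μ)) = y := by
    simp only [chartLevels, norm_exp_smul norm_headVec, dir_exp_smul norm_headVec, Real.log_exp,
      inner_consVec_headVec]
    exact Fin.cons_self_tail y
  have hmem : (rexp (y 0) • headVec N, fun μ : Fin k => consVec (y μ.succ) (ζ μ)) ∈
      chartPart (EuclideanSpace ℝ (Fin (N + 1))) ψ S ↔ ψ (y 0) ≠ 0 ∧ y ∈ S := by
    have h0 : rexp (y 0) • headVec N ≠ 0 :=
      norm_ne_zero_iff.1 (by rw [norm_exp_smul norm_headVec]; exact (Real.exp_pos _).ne')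
    simp only [chartPart, mem_ofPred_eq, hlev, chartDomain, ne_eq, h0, not_false_eq_true, true_and,
      norm_exp_smul norm_headVec, Real.log_exp]
  by_cases h : ψ (y 0) ≠ 0 ∧ y ∈ S
  · rw [chartDensity, if_pos (hmem.2 h), if_pos h, abs_det_fderiv_chartRow hψ y h.1,
      chartRow_consVec]
    have hw := dataWeight_consVec y (completeRows (fun μ => ψ (y μ)) ζ)
    simp only [completeRows, Fin.cons_zero, Fin.cons_succ] at hw ⊢
    rw [hw, Real.exp_neg, ENNReal.ofReal_mul (by positivity), ENNReal.ofReal_mul (by positivity)]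
    have he : ENNReal.ofReal (rexp ((N + 1 : ℕ) * y 0)) *
        ENNReal.ofReal (rexp ((N + 1 : ℕ) * y 0))⁻¹ = 1 := by
      rw [← ENNReal.ofReal_mul (by positivity), mul_inv_cancel₀ (Real.exp_pos _).ne',
        ENNReal.ofReal_one]
    simp only [← mul_assoc]
    rw [he, one_mul]
    ring
  · rw [chartDensity, if_neg (mt hmem.1 h), if_neg h, mul_zero]

lemma measurable_det_critMat {ψ : ℝ → ℝ} (hψ : ContDiff ℝ 1 ψ) :
    Measurable fun p : (Fin (k + 1) → ℝ) × (Fin (k + 1) → Fin N → ℝ) =>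
      (critMat ψ p.1 p.2).det := by
  have hc : Continuous ψ := hψ.continuous
  have hd : Continuous (deriv ψ) := hψ.continuous_deriv le_rfl
  refine (Continuous.matrix_det ?_).measurable
  refine continuous_matrix fun i j => ?_
  simp only [critMat, Matrix.of_apply]
  split_ifs <;> fun_prop

lemma measurable_headLevelIntegrand {ψ : ℝ → ℝ} (hψ : ContDiff ℝ 1 ψ)
    {S : Set (Fin (k + 1) → ℝ)} (hS : MeasurableSet S) :
    Measurable fun y : Fin (k + 1) → ℝ => if ψ (y 0) ≠ 0 ∧ y ∈ S then
      ENNReal.ofReal ((√(∑ μ, ψ (y μ) ^ 2) * √(2 * π))⁻¹ ^ N) *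
        ∫⁻ Z, ENNReal.ofReal |(critMat ψ y (projRows (fun μ => ψ (y μ)) Z)).det|
          ∂(gaussMat (k + 1) N) else 0 := by
  have hc : Measurable ψ := hψ.continuous.measurable
  have hy : ∀ μ, Measurable fun y : Fin (k + 1) → ℝ => ψ (y μ) :=
    fun μ => hc.comp (measurable_pi_apply μ)
  have hA : Measurable fun y : Fin (k + 1) → ℝ => ∑ μ, ψ (y μ) ^ 2 :=
    Finset.measurable_sum _ fun μ _ => (hy μ).pow_const 2
  have hset : MeasurableSet {y : Fin (k + 1) → ℝ | ψ (y 0) ≠ 0 ∧ y ∈ S} :=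
    ((hy 0) (measurableSet_singleton 0).compl).inter hS
  have hZ : ∀ ρ, Measurable fun p : (Fin (k + 1) → ℝ) × (Fin (k + 1) → Fin N → ℝ) => p.2 ρ :=
    fun ρ => (measurable_pi_apply ρ).comp measurable_snd
  have hproj : Measurable fun p : (Fin (k + 1) → ℝ) × (Fin (k + 1) → Fin N → ℝ) =>
      projRows (fun μ => ψ (p.1 μ)) p.2 := by
    refine measurable_pi_iff.2 fun μ => ?_
    have h1 : Measurable fun p : (Fin (k + 1) → ℝ) × (Fin (k + 1) → Fin N → ℝ) =>
        ψ (p.1 μ) / ∑ ρ, ψ (p.1 ρ) ^ 2 := ((hy μ).div hA).comp measurable_fst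
    have h2 : Measurable fun p : (Fin (k + 1) → ℝ) × (Fin (k + 1) → Fin N → ℝ) =>
        ∑ ρ, ψ (p.1 ρ) • p.2 ρ :=
      Finset.measurable_sum _ fun ρ _ => ((hy ρ).comp measurable_fst).smul (hZ ρ)
    exact (hZ μ).sub (h1.smul h2)
  have hdet : Measurable fun p : (Fin (k + 1) → ℝ) × (Fin (k + 1) → Fin N → ℝ) =>
      ENNReal.ofReal |(critMat ψ p.1 (projRows (fun μ => ψ (p.1 μ)) p.2)).det| :=
    ((measurable_det_critMat hψ).comp (measurable_fst.prodMk hproj)).norm.ennreal_ofReal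
  have hint_meas : Measurable fun y : Fin (k + 1) → ℝ =>
      ∫⁻ Z, ENNReal.ofReal |(critMat ψ y (projRows (fun μ => ψ (y μ)) Z)).det|
        ∂(gaussMat (k + 1) N) := hdet.lintegral_prod_right'
  have hcoef : Measurable fun y : Fin (k + 1) → ℝ =>
      ENNReal.ofReal ((√(∑ μ, ψ (y μ) ^ 2) * √(2 * π))⁻¹ ^ N) :=
    (((hA.sqrt.mul_const _).inv).pow_const N).ennreal_ofReal
  exact Measurable.ite hset (hcoef.mul hint_meas) measurable_const

/-- The integral over data and critical points, in terms of the levels. -/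
lemma lintegral_encard_headCrit_eq {ψ : ℝ → ℝ} (hψ : ContDiff ℝ 1 ψ)
    {S : Set (Fin (k + 1) → ℝ)} (hS : MeasurableSet S) :
    ∫⁻ q : EuclideanSpace ℝ (Fin (N + 1)) × (Fin k → EuclideanSpace ℝ (Fin (N + 1))),
        ((headCrit ψ S q).encard : ℝ≥0∞) * dataWeight ((k + 1) * (N + 1)) q =
      (N + 1 : ℕ) * volume (Metric.ball (0 : EuclideanSpace ℝ (Fin (N + 1))) 1) *
        ∫⁻ y, (if ψ (y 0) ≠ 0 ∧ y ∈ S then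
          ENNReal.ofReal ((√(∑ μ, ψ (y μ) ^ 2) * √(2 * π))⁻¹ ^ N) *
            ∫⁻ Z, ENNReal.ofReal |(critMat ψ y (projRows (fun μ => ψ (y μ)) Z)).det|
              ∂(gaussMat (k + 1) N) else 0) ∂(gaussVec (k + 1)) := by
  set g : (Fin (k + 1) → ℝ) → ℝ≥0∞ := fun y => if ψ (y 0) ≠ 0 ∧ y ∈ S then
      ENNReal.ofReal ((√(∑ μ, ψ (y μ) ^ 2) * √(2 * π))⁻¹ ^ N) *
        ∫⁻ Z, ENNReal.ofReal |(critMat ψ y (projRows (fun μ => ψ (y μ)) Z)).det|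
          ∂(gaussMat (k + 1) N) else 0 with hg
  have hgm : Measurable g := measurable_headLevelIntegrand hψ hS
  have hwm : Measurable fun y : Fin (k + 1) → ℝ => gaussWeight (k + 1) (dotp y y) :=
    (measurable_gaussWeight _).comp (measurable_dotp_self _)
  rw [lintegral_encard_headCrit _ hψ hS, lintegral_chartDensity_radial _ hψ hS norm_headVec,
    finrank_euclideanSpace_fin, gaussVec_eq, lintegral_withDensity_eq_lintegral_mul _ hwm hgm,
    lintegral_volume_cons (hwm.mul hgm)]
  congr 1
  refine lintegral_congr fun y₀ => ?_
  have hcd : Measurable fun η : Fin k → EuclideanSpace ℝ (Fin (N + 1)) =>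
      chartDensity ((k + 1) * (N + 1)) ψ S (rexp y₀ • headVec N) η :=
    (measurable_chartDensity _ hψ hS).comp measurable_prodMk_left
  rw [← lintegral_const_mul _ hcd, lintegral_consVec_pi (hcd.const_mul _)]
  refine lintegral_congr fun y' => ?_
  have hfib := fun ζ : Fin k → Fin N → ℝ => chartDensity_consVec hψ S (Fin.cons y₀ y') ζ
  simp only [Fin.cons_zero, Fin.cons_succ] at hfib
  rw [lintegral_congr hfib]
  simp only [Pi.mul_apply, hg, Fin.cons_zero]
  by_cases h : ψ y₀ ≠ 0 ∧ (Fin.cons y₀ y' : Fin (k + 1) → ℝ) ∈ S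
  · simp only [if_pos h]
    set y : Fin (k + 1) → ℝ := Fin.cons y₀ y' with hy
    have ha : (fun μ => ψ (y μ)) 0 ≠ 0 := h.1
    have hfm : Measurable fun Z : Fin (k + 1) → Fin N → ℝ =>
        ENNReal.ofReal |(critMat ψ y Z).det| :=
      ((measurable_det_critMat hψ).comp measurable_prodMk_left).norm.ennreal_ofReal
    have hA : 0 < ∑ ρ, ψ (y ρ) ^ 2 := sum_sq_pos_of_ne (a := fun μ => ψ (y μ)) ha
    have h2 : Measurable fun ζ : Fin k → Fin N → ℝ =>
        ENNReal.ofReal |(critMat ψ y (completeRows (fun μ => ψ (y μ)) ζ)).det| *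
          gaussWeight ((k + 1) * N) (∑ μ, dotp (completeRows (fun μ => ψ (y μ)) ζ μ)
            (completeRows (fun μ => ψ (y μ)) ζ μ)) := by
      refine (hfm.comp (measurable_completeRows _)).mul ((measurable_gaussWeight _).comp ?_)
      exact Finset.measurable_sum _ fun μ _ => (measurable_dotp_self N).comp
        ((measurable_pi_apply μ).comp (measurable_completeRows _))
    rw [lintegral_completeRows ha hfm, lintegral_const_mul _ (h2.const_mul _),
      lintegral_const_mul _ h2, ← mul_assoc (ENNReal.ofReal ((√_ * √_)⁻¹ ^ N)),
      ← ENNReal.ofReal_mul (by positivity)]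
    congr 4
    have h3 : √(∑ ρ, ψ (y ρ) ^ 2) ≠ 0 := (Real.sqrt_pos.2 hA).ne'
    have h4 : √(2 * π) ≠ 0 := (Real.sqrt_pos.2 (by positivity)).ne'
    rw [← mul_pow, ← mul_pow]
    congr 1
    change |ψ y₀|⁻¹ = (_ : ℝ)⁻¹ * (_ / |ψ y₀| * _)
    field_simp
  · simp only [if_neg h, mul_zero, lintegral_zero]

end Coordinates

section LevelCrit

variable {k N n m : ℕ}

/-- The tangential gradient of `x ↦ ∑ Ψ(ξ_μ · x)` at a unit vector `x`, where `ψ = Ψ'`. -/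
def tangentGrad (ψ : ℝ → ℝ) (ξ : Fin m → Fin n → ℝ) (x : Fin n → ℝ) : Fin n → ℝ :=
  ∑ μ, ψ (dotp (ξ μ) x) • (ξ μ - dotp (ξ μ) x • x)

/-- Unit vectors at which the tangential gradient vanishes, with levels in `S`. -/
def levelCrit (ψ : ℝ → ℝ) (S : Set (Fin m → ℝ)) (ξ : Fin m → Fin n → ℝ) : Set (Fin n → ℝ) :=
  {x | dotp x x = 1 ∧ tangentGrad ψ ξ x = 0 ∧ (fun μ => dotp (ξ μ) x) ∈ S}

/-- The data matrix as a head row and the remaining rows, in Euclidean space. -/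
def toRows (ξ : Fin (k + 1) → Fin n → ℝ) :
    EuclideanSpace ℝ (Fin n) × (Fin k → EuclideanSpace ℝ (Fin n)) :=
  (WithLp.toLp 2 (ξ 0), fun μ => WithLp.toLp 2 (ξ μ.succ))

lemma inner_toLp (u v : Fin n → ℝ) :
    inner ℝ (WithLp.toLp 2 u : EuclideanSpace ℝ (Fin n)) (WithLp.toLp 2 v) = dotp u v := by
  simp [PiLp.inner_apply, dotp, mul_comm]

lemma norm_toLp_sq (u : Fin n → ℝ) :
    ‖(WithLp.toLp 2 u : EuclideanSpace ℝ (Fin n))‖ ^ 2 = dotp u u := by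
  rw [← real_inner_self_eq_norm_sq, inner_toLp]

lemma measurePreserving_toRows : MeasurePreserving (toRows (k := k) (n := n)) volume volume := by
  have h1 := volume_preserving_piFinSuccAbove (fun _ : Fin (k + 1) => Fin n → ℝ) 0
  have h2 : MeasurePreserving (fun u : Fin n → ℝ => (WithLp.toLp 2 u : EuclideanSpace ℝ (Fin n))) :=
    PiLp.volume_preserving_toLp (Fin n)
  have h3 := volume_preserving_pi (fun _ : Fin k => h2)
  have h4 := (h2.prod h3).comp h1
  exact h4

lemma encard_levelCrit_eq_headCrit (ψ : ℝ → ℝ) (S : Set (Fin (k + 1) → ℝ))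
    (ξ : Fin (k + 1) → Fin n → ℝ) :
    (levelCrit ψ ({y | ψ (y 0) ≠ 0} ∩ S) ξ).encard = (headCrit ψ S (toRows ξ)).encard := by
  have hinj : Function.Injective
      (fun u : Fin n → ℝ => (WithLp.toLp 2 u : EuclideanSpace ℝ (Fin n))) :=
    WithLp.toLp_injective 2
  rw [← hinj.injOn.encard_image]
  congr 1
  have hiff : ∀ u : Fin n → ℝ, u ∈ levelCrit ψ ({y | ψ (y 0) ≠ 0} ∩ S) ξ ↔
      (WithLp.toLp 2 u : EuclideanSpace ℝ (Fin n)) ∈ headCrit ψ S (toRows ξ) := by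
    intro u
    have hn : dotp u u = 1 ↔ ‖(WithLp.toLp 2 u : EuclideanSpace ℝ (Fin n))‖ = 1 := by
      rw [← norm_toLp_sq]
      constructor
      · intro h
        nlinarith [norm_nonneg (WithLp.toLp 2 u : EuclideanSpace ℝ (Fin n))]
      · intro h
        rw [h, one_pow]
    have hg : (tangentGrad ψ ξ u = 0) ↔
        ψ (dotp (ξ 0) u) • ((WithLp.toLp 2 (ξ 0) : EuclideanSpace ℝ (Fin n)) -
          dotp (ξ 0) u • WithLp.toLp 2 u) +
          tangentSum ψ (toRows ξ).2 (WithLp.toLp 2 u) = 0 := by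
      rw [← hinj.eq_iff, tangentGrad, Fin.sum_univ_succ]
      simp only [WithLp.toLp_add, WithLp.toLp_smul, WithLp.toLp_sub, WithLp.toLp_sum,
        WithLp.toLp_zero, tangentSum, toRows, inner_toLp]
    have hl : (Fin.cons (dotp (ξ 0) u) fun μ : Fin k => dotp (ξ μ.succ) u : Fin (k + 1) → ℝ) =
        fun μ => dotp (ξ μ) u := by
      ext μ
      refine Fin.cases ?_ (fun j => ?_) μ <;> simp
    change dotp u u = 1 ∧ tangentGrad ψ ξ u = 0 ∧ ψ (dotp (ξ 0) u) ≠ 0 ∧ _ ↔ _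
    rw [hn, hg, ← hl]
    simp only [headCrit, toRows, inner_toLp, mem_ofPred_eq]
  ext x
  constructor
  · rintro ⟨u, hu, rfl⟩
    exact (hiff u).1 hu
  · intro hx
    exact ⟨x.ofLp, (hiff _).2 hx, rfl⟩

lemma dataWeight_toRows (d : ℕ) (ξ : Fin (k + 1) → Fin n → ℝ) :
    dataWeight d (toRows ξ) = gaussWeight d (∑ i, dotp (ξ i) (ξ i)) := by
  simp only [dataWeight, toRows, norm_toLp_sq, Fin.sum_univ_succ]

lemma aemeasurable_encard_levelCrit {ψ : ℝ → ℝ} (hψ : ContDiff ℝ 1 ψ) {S : Set (Fin (k + 1) → ℝ)}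
    (hS : MeasurableSet S) :
    AEMeasurable (fun ξ : Fin (k + 1) → Fin (N + 1) → ℝ =>
      ((levelCrit ψ ({y | ψ (y 0) ≠ 0} ∩ S) ξ).encard : ℝ≥0∞)) (gaussMat (k + 1) (N + 1)) := by
  simp only [encard_levelCrit_eq_headCrit]
  have h := (aemeasurable_encard_headCrit (E := EuclideanSpace ℝ (Fin (N + 1))) hψ
    hS).comp_quasiMeasurePreserving measurePreserving_toRows.quasiMeasurePreserving
  rw [gaussMat_eq]
  exact h.mono_ac (withDensity_absolutelyContinuous _ _)

lemma lintegral_encard_levelCrit {ψ : ℝ → ℝ} (hψ : ContDiff ℝ 1 ψ) {S : Set (Fin (k + 1) → ℝ)}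
    (hS : MeasurableSet S) :
    ∫⁻ ξ, ((levelCrit ψ ({y | ψ (y 0) ≠ 0} ∩ S) ξ).encard : ℝ≥0∞) ∂(gaussMat (k + 1) (N + 1)) =
      (N + 1 : ℕ) * volume (Metric.ball (0 : EuclideanSpace ℝ (Fin (N + 1))) 1) *
        ∫⁻ y, (if ψ (y 0) ≠ 0 ∧ y ∈ S then
          ENNReal.ofReal ((√(∑ μ, ψ (y μ) ^ 2) * √(2 * π))⁻¹ ^ N) *
            ∫⁻ Z, ENNReal.ofReal |(critMat ψ y (projRows (fun μ => ψ (y μ)) Z)).det|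
              ∂(gaussMat (k + 1) N) else 0) ∂(gaussVec (k + 1)) := by
  have hw : Measurable fun ξ : Fin (k + 1) → Fin (N + 1) → ℝ =>
      gaussWeight ((k + 1) * (N + 1)) (∑ i, dotp (ξ i) (ξ i)) :=
    (measurable_gaussWeight _).comp (Finset.measurable_sum _ fun i _ =>
      (measurable_dotp_self _).comp (measurable_pi_apply i))
  have hw' : Measurable fun q : EuclideanSpace ℝ (Fin (N + 1)) ×
      (Fin k → EuclideanSpace ℝ (Fin (N + 1))) => dataWeight ((k + 1) * (N + 1)) q :=
    measurable_dataWeight _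
  rw [← lintegral_encard_headCrit_eq hψ hS, gaussMat_eq,
    lintegral_withDensity_eq_lintegral_mul_non_measurable _ hw
      (.of_forall fun _ => ENNReal.ofReal_lt_top),
    ← measurePreserving_toRows.map_eq, lintegral_map' ?_ measurePreserving_toRows.aemeasurable]
  · refine lintegral_congr fun ξ => ?_
    rw [Pi.mul_apply, dataWeight_toRows, encard_levelCrit_eq_headCrit, mul_comm]
  · rw [measurePreserving_toRows.map_eq]
    exact (aemeasurable_encard_headCrit hψ hS).mul hw'.aemeasurable

end LevelCrit

section Degenerate

/-- If the law of `ψ` under the Gaussian measure has a continuous density near `0`, then `ψ` has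
nonzero derivative at its zeros. -/
lemma deriv_ne_zero_of_law {ψ : ℝ → ℝ} (hψ : ContDiff ℝ 1 ψ) {ε : ℝ} (hε : 0 < ε) {f : ℝ → ℝ}
    (hf : ContinuousOn f (Ioo (-ε) ε))
    (hlaw : ∀ s ⊆ Ioo (-ε) ε, MeasurableSet s →
      Measure.map (fun y => ψ y) stdGauss s = ∫⁻ a in s, ENNReal.ofReal (f a))
    {y₀ : ℝ} (h0 : ψ y₀ = 0) : deriv ψ y₀ ≠ 0 := by
  intro hd
  have hder : HasDerivAt ψ 0 y₀ := hd ▸ (hψ.differentiable one_ne_zero y₀).hasDerivAt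
  set p : ℝ := gaussianPDFReal 0 1 y₀ / 2 with hp
  have hp0 : 0 < p := half_pos (gaussianPDFReal_pos 0 1 y₀ one_ne_zero)
  set M : ℝ := |f 0| + 1 with hM
  have hM0 : 0 < M := by positivity
  set c : ℝ := p / (2 * M) with hc
  have hc0 : 0 < c := by positivity
  have hpc : Continuous (gaussianPDFReal 0 1) := by
    unfold gaussianPDFReal
    fun_prop
  have h1 : ∀ᶠ y in 𝓝 y₀, p < gaussianPDFReal 0 1 y :=
    hpc.continuousAt.eventually_const_lt (half_lt_self (gaussianPDFReal_pos 0 1 y₀ one_ne_zero))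
  have h2 : ∀ᶠ y in 𝓝 y₀, |ψ y| ≤ c * |y - y₀| := by
    have := (hasDerivAt_iff_isLittleO.1 hder).def hc0
    simpa [h0] using this
  have h3 : ∀ᶠ a in 𝓝 (0 : ℝ), f a < M :=
    (hf.continuousAt (Ioo_mem_nhds (neg_lt_zero.2 hε) hε)).eventually_lt_const
      (lt_of_le_of_lt (le_abs_self _) (lt_add_one _))
  obtain ⟨δ₀, hδ₀, h12⟩ := Metric.eventually_nhds_iff.1 (h1.and h2)
  obtain ⟨ε₁, hε₁, h3'⟩ := Metric.eventually_nhds_iff.1 h3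
  set δ : ℝ := min (δ₀ / 2) (min ε₁ ε / (2 * c)) with hδ
  have hm0 : 0 < min ε₁ ε := lt_min hε₁ hε
  have hδ0 : 0 < δ := by positivity
  have hδ1 : δ < δ₀ := lt_of_le_of_lt (min_le_left _ _) (half_lt_self hδ₀)
  have hδ2 : c * δ < min ε₁ ε := by
    have : δ ≤ min ε₁ ε / (2 * c) := min_le_right _ _
    rw [le_div_iff₀ (by positivity)] at this
    nlinarith
  have hlow : ENNReal.ofReal (p * (2 * δ)) ≤ stdGauss (Icc (y₀ - δ) (y₀ + δ)) := by
    rw [stdGauss, gaussianReal_apply _ one_ne_zero]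
    calc ENNReal.ofReal (p * (2 * δ))
        = ∫⁻ _ in Icc (y₀ - δ) (y₀ + δ), ENNReal.ofReal p := by
          rw [setLIntegral_const, Real.volume_Icc, ← ENNReal.ofReal_mul hp0.le]
          ring_nf
      _ ≤ _ := by
          refine setLIntegral_mono (measurable_gaussianPDF 0 1) fun y hy => ?_
          refine ENNReal.ofReal_le_ofReal (h12 ?_).1.le
          rw [Real.dist_eq]
          exact lt_of_le_of_lt (abs_le.2 ⟨by linarith [hy.1], by linarith [hy.2]⟩) hδ1
  have hupp : stdGauss (Icc (y₀ - δ) (y₀ + δ)) ≤ ENNReal.ofReal (M * (2 * (c * δ))) := by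
    calc stdGauss (Icc (y₀ - δ) (y₀ + δ))
        ≤ stdGauss (ψ ⁻¹' Icc (-(c * δ)) (c * δ)) := by
          refine measure_mono fun y hy => ?_
          have hy' : |y - y₀| ≤ δ := abs_le.2 ⟨by linarith [hy.1], by linarith [hy.2]⟩
          have := (h12 (y := y) (by rw [Real.dist_eq]; exact lt_of_le_of_lt hy' hδ1)).2
          exact abs_le.1 (this.trans (mul_le_mul_of_nonneg_left hy' hc0.le))
      _ = Measure.map (fun y => ψ y) stdGauss (Icc (-(c * δ)) (c * δ)) :=
          (Measure.map_apply hψ.continuous.measurable measurableSet_Icc).symm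
      _ = ∫⁻ a in Icc (-(c * δ)) (c * δ), ENNReal.ofReal (f a) := by
          refine hlaw _ (fun a ha => ?_) measurableSet_Icc
          have := min_le_right ε₁ ε
          exact ⟨by linarith [ha.1], by linarith [ha.2]⟩
      _ ≤ ∫⁻ _ in Icc (-(c * δ)) (c * δ), ENNReal.ofReal M := by
          refine setLIntegral_mono measurable_const fun a ha => ?_
          refine ENNReal.ofReal_le_ofReal (h3' ?_).le
          rw [Real.dist_eq, sub_zero]
          exact lt_of_le_of_lt (abs_le.2 ha) (lt_of_lt_of_le hδ2 (min_le_left _ _))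
      _ = ENNReal.ofReal (M * (2 * (c * δ))) := by
          rw [setLIntegral_const, Real.volume_Icc, ← ENNReal.ofReal_mul hM0.le]
          ring_nf
  have h := (ENNReal.ofReal_le_ofReal_iff (by positivity)).1 (hlow.trans hupp)
  have hcM : M * c = p / 2 := by rw [hc]; field_simp
  have : M * (2 * (c * δ)) = p * δ := by
    calc M * (2 * (c * δ)) = 2 * (M * c) * δ := by ring
      _ = p * δ := by rw [hcM]; ring
  nlinarith [mul_pos hp0 hδ0]

lemma countable_zeros_of_deriv_ne_zero {ψ : ℝ → ℝ}
    (hd : ∀ y, ψ y = 0 → deriv ψ y ≠ 0) : {y | ψ y = 0}.Countable := by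
  have : DiscreteTopology {y | ψ y = 0} := by
    refine discreteTopology_subtype_iff.2 fun y hy => ?_
    have hne := (differentiableAt_of_deriv_ne_zero (hd y hy)).hasDerivAt.eventually_ne (c := 0)
      (hd y hy)
    rw [inf_principal_eq_bot]
    exact hne
  exact (countable_of_Lindelof_of_discrete : Countable {y | ψ y = 0})

variable {k n : ℕ}

lemma ae_det_rows_ne_zero (h : n ≤ k) :
    ∀ᵐ A : Fin k → Fin n → ℝ, (Matrix.of fun i => A (Fin.castLE h i)).det ≠ 0 := by
  set d : (Fin k → Fin n → ℝ) → ℝ := fun A => (Matrix.of fun i => A (Fin.castLE h i)).det with hd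
  have hdc : Continuous d := by
    refine Continuous.matrix_det (continuous_matrix fun i j => ?_)
    exact (continuous_apply j).comp (continuous_apply (Fin.castLE h i))
  set T : Fin k → Fin n → ℝ := fun μ j => if (μ : ℕ) = j then 1 else 0 with hT
  have hfin : ∀ A : Fin k → Fin n → ℝ, {t : ℝ | d (A + t • T) = 0}.Finite := by
    intro A
    refine ((-(Matrix.of fun i => A (Fin.castLE h i))).charpoly.roots.toFinset).finite_toSet.subset
      fun t ht => ?_
    rw [Finset.mem_coe, Multiset.mem_toFinset,
      Polynomial.mem_roots (Matrix.charpoly_monic _).ne_zero, Polynomial.IsRoot,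
      Matrix.eval_charpoly, ← (show d (A + t • T) = 0 from ht), hd]
    congr 1
    ext i j
    simp [hT, Matrix.scalar_apply, Matrix.diagonal_apply, Fin.ext_iff, add_comm]
  have hms : MeasurableSet {A : Fin k → Fin n → ℝ | d A = 0} :=
    (isClosed_singleton.preimage hdc).measurableSet
  have hmi : Measurable (indicator {A : Fin k → Fin n → ℝ | d A = 0} (fun _ => (1 : ℝ≥0∞))) :=
    measurable_const.indicator hms
  have hm2 : Measurable fun p : ℝ × (Fin k → Fin n → ℝ) =>
      indicator {A : Fin k → Fin n → ℝ | d A = 0} (fun _ => (1 : ℝ≥0∞)) (p.2 + p.1 • T) :=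
    hmi.comp (measurable_snd.add (measurable_fst.smul_const T))
  have h1 : ∫⁻ t in Icc (0 : ℝ) 1, ∫⁻ A : Fin k → Fin n → ℝ,
      indicator {A : Fin k → Fin n → ℝ | d A = 0} (fun _ => (1 : ℝ≥0∞)) (A + t • T) =
        volume {A : Fin k → Fin n → ℝ | d A = 0} := by
    simp [lintegral_add_right_eq_self, lintegral_indicator_const hms]
  rw [lintegral_lintegral_swap hm2.aemeasurable] at h1
  rw [ae_iff]
  simp only [not_not]
  rw [← hd] at *
  rw [← h1, lintegral_eq_zero_iff (hm2.lintegral_prod_left')]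
  refine .of_forall fun A => ?_
  refine (lintegral_eq_zero_iff (hm2.comp measurable_prodMk_right)).2 ?_
  refine ae_restrict_of_ae ?_
  filter_upwards [(hfin A).countable.ae_notMem volume] with t ht
  have ht' : A + t • T ∉ {A | d A = 0} := ht
  exact indicator_of_notMem ht' fun _ => (1 : ℝ≥0∞)

lemma ae_dotp_ne {w : Fin n → ℝ} {i : Fin n} (hi : w i ≠ 0) (c : ℝ) :
    ∀ᵐ v : Fin n → ℝ, dotp v w ≠ c := by
  let ℓ : (Fin n → ℝ) →ₗ[ℝ] ℝ := Fintype.linearCombination ℝ w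
  have hℓ : ∀ v, ℓ v = dotp v w := fun v => by
    simp [ℓ, Fintype.linearCombination_apply, dotp]
  have hs : ∀ t : ℝ, ℓ (Pi.single i t) = t * w i := fun t => by
    simp [hℓ, dotp, Pi.single_apply]
  let s : AffineSubspace ℝ (Fin n → ℝ) :=
    AffineSubspace.mk' (Pi.single i (c / w i)) (LinearMap.ker ℓ)
  have hmem : ∀ v, v ∈ s ↔ dotp v w = c := fun v => by
    rw [AffineSubspace.mem_mk', LinearMap.mem_ker, vsub_eq_sub, map_sub, hs, hℓ,
      div_mul_cancel₀ _ hi, sub_eq_zero]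
  have hne : s ≠ ⊤ := by
    intro htop
    have h1 : (Pi.single i ((c + 1) / w i) : Fin n → ℝ) ∈ s := htop ▸ AffineSubspace.mem_top _ _ _
    rw [hmem, ← hℓ, hs, div_mul_cancel₀ _ hi] at h1
    linarith
  rw [ae_iff]
  simp only [not_not, ← hmem]
  exact Measure.addHaar_affineSubspace volume s hne

lemma ae_forall_exists_dotp_ne (h : n ≤ k) (z : Fin (k + 1) → ℝ) :
    ∀ᵐ ξ : Fin (k + 1) → Fin n → ℝ, ∀ x ≠ 0, ∃ μ, dotp (ξ μ) x ≠ z μ := by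
  set R : (Fin k → Fin n → ℝ) → Matrix (Fin n) (Fin n) ℝ :=
    fun A => Matrix.of fun i => A (Fin.castLE h i) with hR
  have hRc : Continuous R := continuous_matrix fun i j =>
    (continuous_apply j).comp (continuous_apply (Fin.castLE h i))
  set w : (Fin k → Fin n → ℝ) → (Fin n → ℝ) :=
    fun A => (R A).adjugate *ᵥ fun i => z (Fin.castLE h i).succ with hw
  have hwc : Continuous w := hRc.matrix_adjugate.matrix_mulVec continuous_const
  have hdc : Continuous fun A => (R A).det := hRc.matrix_det
  have key : ∀ᵐ q : (Fin k → Fin n → ℝ) × (Fin n → ℝ) ∂(volume.prod volume),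
      w q.1 ≠ 0 → dotp q.2 (w q.1) ≠ (R q.1).det * z 0 := by
    have hms : MeasurableSet {q : (Fin k → Fin n → ℝ) × (Fin n → ℝ) |
        w q.1 ≠ 0 → dotp q.2 (w q.1) ≠ (R q.1).det * z 0} := by
      have h1 : MeasurableSet {q : (Fin k → Fin n → ℝ) × (Fin n → ℝ) | w q.1 = 0} :=
        (isClosed_eq (hwc.comp continuous_fst) continuous_const).measurableSet
      have hdot : Continuous fun q : (Fin k → Fin n → ℝ) × (Fin n → ℝ) => dotp q.2 (w q.1) := by
        unfold dotp
        fun_prop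
      have h2 : MeasurableSet {q : (Fin k → Fin n → ℝ) × (Fin n → ℝ) |
          dotp q.2 (w q.1) = (R q.1).det * z 0} :=
        (isClosed_eq hdot ((hdc.comp continuous_fst).mul continuous_const)).measurableSet
      exact h1.compl.imp h2.compl
    rw [Measure.ae_prod_iff_ae_ae hms]
    refine .of_forall fun A => ?_
    by_cases hA : w A = 0
    · exact .of_forall fun v hv => absurd hA hv
    · obtain ⟨i, hi⟩ := Function.ne_iff.1 hA
      exact (ae_dotp_ne hi ((R A).det * z 0)).mono fun v hv _ => hv
  have hmp : MeasurePreserving (fun ξ : Fin (k + 1) → Fin n → ℝ => (fun μ : Fin k => ξ μ.succ, ξ 0))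
      volume (volume.prod volume) :=
    Measure.measurePreserving_swap.comp
      (volume_preserving_piFinSuccAbove (fun _ : Fin (k + 1) => Fin n → ℝ) 0)
  have hdet : ∀ᵐ q : (Fin k → Fin n → ℝ) × (Fin n → ℝ) ∂(volume.prod volume), (R q.1).det ≠ 0 :=
    Measure.quasiMeasurePreserving_fst.ae (ae_det_rows_ne_zero h)
  filter_upwards [hmp.quasiMeasurePreserving.ae key, hmp.quasiMeasurePreserving.ae hdet]
    with ξ h1 h2 x hx
  by_contra! hall
  set A : Fin k → Fin n → ℝ := fun μ => ξ μ.succ with hA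
  have hRx : R A *ᵥ x = fun i => z (Fin.castLE h i).succ := by
    ext i
    exact hall (Fin.castLE h i).succ
  have hwx : w A = (R A).det • x := by
    rw [hw]
    simp only
    rw [← hRx, Matrix.mulVec_mulVec, Matrix.adjugate_mul, Matrix.smul_mulVec, Matrix.one_mulVec]
  refine h1 ?_ ?_
  · rw [hwx]
    exact smul_ne_zero h2 hx
  · rw [hwx, ← hall 0]
    simp only [dotp, Pi.smul_apply, smul_eq_mul, Finset.mul_sum]
    exact Finset.sum_congr rfl fun i _ => by ring

lemma ae_forall_exists_notMem {Z : Set ℝ} (hZ : Z.Countable) (h : n ≤ k) :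
    ∀ᵐ ξ : Fin (k + 1) → Fin n → ℝ, ∀ x ≠ 0, ∃ μ, dotp (ξ μ) x ∉ Z := by
  have hc : {z : Fin (k + 1) → ℝ | ∀ μ, z μ ∈ Z}.Countable :=
    Set.countable_pi fun _ => hZ
  filter_upwards [(ae_ball_iff hc).2 fun z _ => ae_forall_exists_dotp_ne h z] with ξ hξ x hx
  by_contra! hall
  obtain ⟨μ, hμ⟩ := hξ (fun μ => dotp (ξ μ) x) hall x hx
  exact hμ rfl

variable {N : ℕ} {ψ : ℝ → ℝ}

lemma levelCrit_comp_perm (ψ : ℝ → ℝ) (S : Set (Fin (k + 1) → ℝ)) (σ : Equiv.Perm (Fin (k + 1)))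
    (ξ : Fin (k + 1) → Fin n → ℝ) :
    levelCrit ψ S (fun μ => ξ (σ μ)) = levelCrit ψ {y | (fun μ => y (σ μ)) ∈ S} ξ := by
  have h : ∀ x, tangentGrad ψ (fun μ => ξ (σ μ)) x = tangentGrad ψ ξ x := fun x =>
    Equiv.sum_comp σ fun μ => ψ (dotp (ξ μ) x) • (ξ μ - dotp (ξ μ) x • x)
  ext x
  simp only [levelCrit, h, mem_ofPred_eq]

lemma measurePreserving_comp_perm (σ : Equiv.Perm (Fin (k + 1))) :
    MeasurePreserving (fun (ξ : Fin (k + 1) → Fin n → ℝ) μ => ξ (σ μ))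
      (gaussMat (k + 1) n) (gaussMat (k + 1) n) := by
  have h := measurePreserving_piCongrLeft (fun _ : Fin (k + 1) => gaussVec n) σ.symm
  have he : ⇑(MeasurableEquiv.piCongrLeft (fun _ : Fin (k + 1) => Fin n → ℝ) σ.symm) =
      fun (ξ : Fin (k + 1) → Fin n → ℝ) μ => ξ (σ μ) := by
    ext ξ μ
    obtain ⟨ν, rfl⟩ := σ.symm.surjective μ
    rw [MeasurableEquiv.coe_piCongrLeft, Equiv.piCongrLeft_apply_apply, Equiv.apply_symm_apply]
  rw [he] at h
  exact h

lemma ae_gaussVec_ne_zero (hZ : {y | ψ y = 0}.Countable)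
    (μ : Fin k) : ∀ᵐ y ∂(gaussVec k), ψ (y μ) ≠ 0 := by
  have h : ∀ᵐ t ∂stdGauss, ψ t ≠ 0 := by
    have : NullSingletonClass stdGauss := nullSingletonClass_gaussianReal one_ne_zero
    exact hZ.ae_notMem stdGauss
  exact (measurePreserving_eval (fun _ : Fin k => stdGauss) μ).quasiMeasurePreserving.ae h

lemma ae_levelCrit_vanishing_eq_empty (hψ : ContDiff ℝ 1 ψ) (hZ : {y | ψ y = 0}.Countable)
    (ν : Fin (k + 1)) :
    ∀ᵐ ξ ∂(gaussMat (k + 1) (N + 1)), levelCrit ψ {y | ψ (y ν) ≠ 0 ∧ ψ (y 0) = 0} ξ = ∅ := by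
  have hS : MeasurableSet {y : Fin (k + 1) → ℝ | ψ (y ν) = 0} := by
    have hm : Measurable fun y : Fin (k + 1) → ℝ => ψ (y ν) :=
      hψ.continuous.measurable.comp (measurable_pi_apply ν)
    exact hm (measurableSet_singleton 0)
  have h0 := lintegral_encard_levelCrit (N := N) hψ hS
  have hz : ∫⁻ y, (if ψ (y 0) ≠ 0 ∧ y ∈ {y : Fin (k + 1) → ℝ | ψ (y ν) = 0} then
      ENNReal.ofReal ((√(∑ μ, ψ (y μ) ^ 2) * √(2 * π))⁻¹ ^ N) *
        ∫⁻ Z, ENNReal.ofReal |(critMat ψ y (projRows (fun μ => ψ (y μ)) Z)).det|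
          ∂(gaussMat (k + 1) N) else 0) ∂(gaussVec (k + 1)) = 0 := by
    refine (lintegral_congr_ae (g := fun _ => 0) ?_).trans lintegral_zero
    filter_upwards [ae_gaussVec_ne_zero hZ ν] with y hy
    exact if_neg fun h : ψ (y 0) ≠ 0 ∧ ψ (y ν) = 0 => hy h.2
  rw [hz, mul_zero, lintegral_eq_zero_iff' (aemeasurable_encard_levelCrit hψ hS)] at h0
  filter_upwards [(measurePreserving_comp_perm (Equiv.swap 0 ν)).quasiMeasurePreserving.ae h0]
    with ξ hξ
  rw [levelCrit_comp_perm] at hξ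
  have h1 : (levelCrit ψ {y | (fun μ => y (Equiv.swap 0 ν μ)) ∈
      {y | ψ (y 0) ≠ 0} ∩ {y | ψ (y ν) = 0}} ξ).encard = 0 := by
    simpa using hξ
  rw [encard_eq_zero] at h1
  simpa using h1

/-- The expected number of critical points, in terms of the levels. -/
lemma lintegral_encard_levelCrit_of_countable (hψ : ContDiff ℝ 1 ψ)
    (hZ : {y | ψ y = 0}.Countable) (hNk : N + 1 ≤ k) {S : Set (Fin (k + 1) → ℝ)}
    (hS : MeasurableSet S) :
    ∫⁻ ξ, ((levelCrit ψ S ξ).encard : ℝ≥0∞) ∂(gaussMat (k + 1) (N + 1)) =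
      (N + 1 : ℕ) * volume (Metric.ball (0 : EuclideanSpace ℝ (Fin (N + 1))) 1) *
        ∫⁻ y, (if y ∈ S then
          ENNReal.ofReal ((√(∑ μ, ψ (y μ) ^ 2) * √(2 * π))⁻¹ ^ N) *
            ∫⁻ Z, ENNReal.ofReal |(critMat ψ y (projRows (fun μ => ψ (y μ)) Z)).det|
              ∂(gaussMat (k + 1) N) else 0) ∂(gaussVec (k + 1)) := by
  have hac : gaussMat (k + 1) (N + 1) ≪ volume := by
    rw [gaussMat_eq]
    exact withDensity_absolutelyContinuous _ _
  have h1 : ∫⁻ ξ, ((levelCrit ψ S ξ).encard : ℝ≥0∞) ∂(gaussMat (k + 1) (N + 1)) =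
      ∫⁻ ξ, ((levelCrit ψ ({y | ψ (y 0) ≠ 0} ∩ S) ξ).encard : ℝ≥0∞)
        ∂(gaussMat (k + 1) (N + 1)) := by
    refine lintegral_congr_ae ?_
    filter_upwards [hac.ae_le (ae_forall_exists_notMem hZ hNk),
      ae_all_iff.2 fun ν => ae_levelCrit_vanishing_eq_empty (N := N) (k := k) hψ hZ ν]
      with ξ hex hempty
    have : levelCrit ψ S ξ = levelCrit ψ ({y | ψ (y 0) ≠ 0} ∩ S) ξ := by
      ext x
      refine ⟨fun hx => ⟨hx.1, hx.2.1, fun h0 => ?_, hx.2.2⟩, fun hx => ⟨hx.1, hx.2.1, hx.2.2.2⟩⟩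
      have hx0 : x ≠ 0 := by
        rintro rfl
        simpa [dotp] using hx.1
      obtain ⟨ν, hν⟩ := hex x hx0
      have hmem : x ∈ levelCrit ψ {y | ψ (y ν) ≠ 0 ∧ ψ (y 0) = 0} ξ := ⟨hx.1, hx.2.1, hν, h0⟩
      rw [hempty ν] at hmem
      exact hmem
    rw [this]
  rw [h1, lintegral_encard_levelCrit hψ hS]
  congr 1
  refine lintegral_congr_ae ?_
  filter_upwards [ae_gaussVec_ne_zero hZ 0] with y hy
  simp [hy]

end Degenerate

section GaussianMoments

lemma memLp_mul_of_forall {Ω : Type*} [MeasurableSpace Ω] {μ : Measure Ω} {f g : Ω → ℝ}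
    (hf : ∀ p : ℝ≥0∞, p ≠ ∞ → MemLp f p μ) (hg : ∀ p : ℝ≥0∞, p ≠ ∞ → MemLp g p μ)
    (p : ℝ≥0∞) (hp : p ≠ ∞) : MemLp (f * g) p μ := by
  have : ENNReal.HolderTriple (2 * p) (2 * p) p := ⟨by
    rw [ENNReal.mul_inv (.inl two_ne_zero) (.inl ENNReal.ofNat_ne_top), ← add_mul,
      ENNReal.inv_two_add_inv_two, one_mul]⟩
  have h2 : 2 * p ≠ ∞ := ENNReal.mul_ne_top ENNReal.ofNat_ne_top hp
  exact (hg _ h2).mul (hf _ h2)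

lemma integrable_det_of_memLp {Ω : Type*} [MeasurableSpace Ω] {μ : Measure Ω}
    [IsFiniteMeasure μ] {N : ℕ} {M : Ω → Matrix (Fin N) (Fin N) ℝ}
    (hM : ∀ i j, ∀ p : ℝ≥0∞, p ≠ ∞ → MemLp (fun ω => M ω i j) p μ) :
    Integrable (fun ω => (M ω).det) μ := by
  simp only [Matrix.det_apply]
  refine integrable_finsetSum _ fun σ _ => Integrable.smul _ ?_
  have h : ∀ p : ℝ≥0∞, p ≠ ∞ → MemLp (∏ i, fun ω => M ω (σ i) i) p μ :=
    Finset.prod_induction (fun i ω => M ω (σ i) i)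
      (fun f => ∀ p : ℝ≥0∞, p ≠ ∞ → MemLp f p μ) (fun f g hf hg => memLp_mul_of_forall hf hg)
      (fun p _ => memLp_const 1) fun i _ => hM (σ i) i
  have h1 := memLp_one_iff_integrable.1 (h 1 ENNReal.one_ne_top)
  simpa only [Finset.prod_fn] using h1

lemma memLp_gaussMat_apply {a b : ℕ} (i : Fin a) (j : Fin b) (p : ℝ≥0∞) (hp : p ≠ ∞) :
    MemLp (fun z : Fin a → Fin b → ℝ => z i j) p (gaussMat a b) := by
  have h1 := measurePreserving_eval (fun _ : Fin a => gaussVec b) i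
  have h2 := measurePreserving_eval (fun _ : Fin b => stdGauss) j
  exact (memLp_id_gaussianReal' (μ := 0) (v := 1) p hp).comp_measurePreserving (h2.comp h1)

/-- Transposition preserves the law of a Gaussian matrix. -/
lemma measurePreserving_transpose (a b : ℕ) :
    MeasurePreserving (fun (z : Fin a → Fin b → ℝ) j i => z i j) (gaussMat a b) (gaussMat b a) := by
  have hcurry : ∀ c d : ℕ, MeasurePreserving (MeasurableEquiv.curry (Fin c) (Fin d) ℝ)
      (Measure.pi fun _ : Fin c × Fin d => stdGauss) (gaussMat c d) := fun c d => by
    refine ⟨MeasurableEquiv.measurable _, ?_⟩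
    have h := Measure.infinitePi_map_curry (fun (_ : Fin c) (_ : Fin d) => stdGauss)
    simp only [Measure.infinitePi_eq_pi] at h
    exact h
  have hswap := measurePreserving_piCongrLeft (fun _ : Fin b × Fin a => stdGauss)
    (Equiv.prodComm (Fin a) (Fin b))
  have h := ((hcurry b a).comp hswap).comp (hcurry a b).symm
  have he : (⇑(MeasurableEquiv.curry (Fin b) (Fin a) ℝ) ∘ ⇑(MeasurableEquiv.piCongrLeft
      (fun _ : Fin b × Fin a => ℝ) (Equiv.prodComm (Fin a) (Fin b)))) ∘
      ⇑(MeasurableEquiv.curry (Fin a) (Fin b) ℝ).symm =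
      fun (z : Fin a → Fin b → ℝ) j i => z i j := by
    ext z j i
    change (Equiv.piCongrLeft (fun _ : Fin b × Fin a => ℝ) (Equiv.prodComm (Fin a) (Fin b)))
      (fun q => z q.1 q.2) (Equiv.prodComm (Fin a) (Fin b) (i, j)) = z i j
    rw [Equiv.piCongrLeft_apply_apply]
  rw [he] at h
  exact h

end GaussianMoments

section Hessian

variable {k N : ℕ} {φ : ℝ → ℝ}

lemma mul_Pperp_apply (φ : ℝ → ℝ) {m : ℕ} (y : Fin m → ℝ) (z : Fin N → Fin m → ℝ) (i : Fin N)
    (μ : Fin m) : (Matrix.of z * Pperp φ y) i μ =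
      z i μ - deriv φ (y μ) / (∑ ρ, deriv φ (y ρ) ^ 2) * ∑ ρ, deriv φ (y ρ) * z i ρ := by
  rw [Pperp, Matrix.mul_sub, Matrix.mul_one, Matrix.sub_apply, Matrix.mul_apply, Finset.mul_sum]
  simp only [Matrix.of_apply]
  congr 1
  exact Finset.sum_congr rfl fun ρ _ => by ring

/-- The Hessian matrix `H_{N+1}^Λ`, entrywise. -/
def hessMat (φ : ℝ → ℝ) {m : ℕ} (y : Fin m → ℝ) (z : Fin N → Fin m → ℝ) :
    Matrix (Fin N) (Fin N) ℝ :=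
  Matrix.of fun i j => ((N + 1 : ℕ) : ℝ)⁻¹ *
      (∑ μ, (Matrix.of z * Pperp φ y) i μ * (((N + 1 : ℕ) : ℝ) / m * deriv (deriv φ) (y μ)) *
        (Matrix.of z * Pperp φ y) j μ) -
      if i = j then 1 / (m : ℝ) * ∑ μ, y μ * deriv φ (y μ) else 0

lemma Hmat_eq_hessMat (φ : ℝ → ℝ) {m : ℕ} (y : Fin m → ℝ) (z : Fin N → Fin m → ℝ) :
    Hmat φ (N + 1) y z = hessMat φ y z := by
  have hT : (Pperp φ y)ᵀ = Pperp φ y := by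
    ext μ ν
    simp [Pperp, Matrix.one_apply, eq_comm, mul_comm]
  have h1 : Matrix.of z * Lam φ (N + 1) y * (Matrix.of z)ᵀ =
      Matrix.of z * Pperp φ y * Dmat φ (N + 1) y * (Matrix.of z * Pperp φ y)ᵀ := by
    rw [Lam, Matrix.transpose_mul, hT]
    simp only [Matrix.mul_assoc]
  ext i j
  have h2 : Hmat φ (N + 1) y z i j = ((N + 1 : ℕ) : ℝ)⁻¹ *
      (Matrix.of z * Lam φ (N + 1) y * (Matrix.of z)ᵀ) i j -
      ((1 / (m : ℝ)) * ∑ μ, y μ * deriv φ (y μ)) * (1 : Matrix (Fin N) (Fin N) ℝ) i j := rfl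
  rw [h2, h1, Matrix.mul_apply, Matrix.one_apply, mul_ite, mul_one, mul_zero]
  simp only [Dmat, Matrix.mul_diagonal, Matrix.transpose_apply, hessMat, Matrix.of_apply]

lemma Edet_eq_integral_hessMat (φ : ℝ → ℝ) {m : ℕ} (y : Fin m → ℝ) :
    Edet φ (N + 1) m y = ∫ z, |(hessMat φ y z).det| ∂(gaussMat N m) :=
  integral_congr_ae (μ := gaussMat N m) (.of_forall fun z =>
    congrArg (fun M : Matrix (Fin N) (Fin N) ℝ => |M.det|) (Hmat_eq_hessMat φ y z))

lemma critMat_projRows (φ : ℝ → ℝ) (y : Fin (k + 1) → ℝ) (z : Fin N → Fin (k + 1) → ℝ) :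
    critMat (deriv φ) y (projRows (fun μ => deriv φ (y μ)) fun μ i => z i μ) =
      ((k + 1 : ℕ) : ℝ) • hessMat φ y z := by
  have hk : ((k + 1 : ℕ) : ℝ) ≠ 0 := by positivity
  have hN : ((N + 1 : ℕ) : ℝ) ≠ 0 := by positivity
  have hp : ∀ μ i, projRows (fun μ => deriv φ (y μ)) (fun μ i => z i μ) μ i =
      (Matrix.of z * Pperp φ y) i μ := fun μ i => by
    rw [mul_Pperp_apply]
    simp [projRows]
  ext i j
  rw [Matrix.smul_apply, smul_eq_mul]
  simp only [critMat, hessMat, Matrix.of_apply, hp]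
  rw [mul_sub, mul_ite, mul_zero, ← mul_assoc _ (1 / _), mul_one_div_cancel hk, one_mul]
  congr 1
  · rw [Finset.mul_sum, Finset.mul_sum]
    refine Finset.sum_congr rfl fun μ _ => ?_
    field_simp
  · simp only [mul_comm]

lemma integrable_det_hessMat (φ : ℝ → ℝ) {m : ℕ} (y : Fin m → ℝ) :
    Integrable (fun z : Fin N → Fin m → ℝ => (hessMat φ y z).det) (gaussMat N m) := by
  refine integrable_det_of_memLp fun i j => ?_
  have hP : ∀ i μ, ∀ p : ℝ≥0∞, p ≠ ∞ →
      MemLp (fun z : Fin N → Fin m → ℝ => (Matrix.of z * Pperp φ y) i μ) p (gaussMat N m) := by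
    intro i μ p hp
    simp only [mul_Pperp_apply]
    refine (memLp_gaussMat_apply i μ p hp).sub (MemLp.const_mul ?_ _)
    exact memLp_finsetSum _ fun ρ _ => (memLp_gaussMat_apply i ρ p hp).const_mul _
  intro p hp
  simp only [hessMat, Matrix.of_apply]
  refine MemLp.sub ?_ (memLp_const _)
  refine MemLp.const_mul ?_ _
  refine memLp_finsetSum _ fun μ _ => ?_
  exact memLp_mul_of_forall (f := fun z : Fin N → Fin m → ℝ => (Matrix.of z * Pperp φ y) i μ *
    (((N + 1 : ℕ) : ℝ) / m * deriv (deriv φ) (y μ)))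
    (g := fun z : Fin N → Fin m → ℝ => (Matrix.of z * Pperp φ y) j μ)
    (fun q hq => (hP i μ q hq).mul_const _) (hP j μ) p hp

lemma measurable_det_hessMat (φ : ℝ → ℝ) (m : ℕ) :
    Measurable fun p : (Fin m → ℝ) × (Fin N → Fin m → ℝ) => (hessMat φ p.1 p.2).det := by
  have hd : Measurable (deriv φ) := measurable_deriv φ
  have hdd : Measurable (deriv (deriv φ)) := measurable_deriv _
  have hent : ∀ i j, Measurable fun p : (Fin m → ℝ) × (Fin N → Fin m → ℝ) =>
      hessMat φ p.1 p.2 i j := by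
    intro i j
    simp only [hessMat, Matrix.of_apply, mul_Pperp_apply]
    split_ifs <;> fun_prop
  simp only [Matrix.det_apply]
  fun_prop

lemma measurable_Edet (φ : ℝ → ℝ) (m : ℕ) : Measurable (Edet φ (N + 1) m) := by
  have h : StronglyMeasurable fun p : (Fin m → ℝ) × (Fin N → Fin m → ℝ) =>
      |(hessMat φ p.1 p.2).det| := (measurable_det_hessMat φ m).norm.stronglyMeasurable
  have h1 := h.integral_prod_right' (ν := gaussMat N m)
  rw [show Edet φ (N + 1) m = _ from funext fun y => Edet_eq_integral_hessMat φ y]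
  exact h1.measurable

lemma Edet_nonneg (φ : ℝ → ℝ) (n m : ℕ) (y : Fin m → ℝ) : 0 ≤ Edet φ n m y :=
  integral_nonneg fun _ => abs_nonneg _

lemma lintegral_det_critMat (φ : ℝ → ℝ) (y : Fin (k + 1) → ℝ) :
    ∫⁻ Z, ENNReal.ofReal |(critMat (deriv φ) y (projRows (fun μ => deriv φ (y μ)) Z)).det|
      ∂(gaussMat (k + 1) N) =
      ENNReal.ofReal (((k + 1 : ℕ) : ℝ) ^ N * Edet φ (N + 1) (k + 1) y) := by
  have hdet : ∀ z : Fin N → Fin (k + 1) → ℝ,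
      |(critMat (deriv φ) y (projRows (fun μ => deriv φ (y μ)) fun μ i => z i μ)).det| =
        ((k + 1 : ℕ) : ℝ) ^ N * |(hessMat φ y z).det| := fun z => by
    rw [critMat_projRows, Matrix.det_smul, Fintype.card_fin, abs_mul,
      abs_of_pos (by positivity : (0 : ℝ) < ((k + 1 : ℕ) : ℝ) ^ N)]
  have hm : Measurable fun Z : Fin (k + 1) → Fin N → ℝ => ENNReal.ofReal
      |(critMat (deriv φ) y (projRows (fun μ => deriv φ (y μ)) Z)).det| := by
    have hd : Measurable fun Z : Fin (k + 1) → Fin N → ℝ => (hessMat φ y fun i μ => Z μ i).det :=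
      ((measurable_det_hessMat φ (k + 1)).comp measurable_prodMk_left).comp
        (measurePreserving_transpose (k + 1) N).measurable
    have := fun Z : Fin (k + 1) → Fin N → ℝ => hdet fun i μ => Z μ i
    simp only [this]
    exact (hd.norm.const_mul _).ennreal_ofReal
  rw [← (measurePreserving_transpose N (k + 1)).lintegral_comp hm, Edet_eq_integral_hessMat,
    ← integral_const_mul, ofReal_integral_eq_lintegral_ofReal
      ((integrable_det_hessMat φ y).abs.const_mul _) (.of_forall fun z => by positivity)]
  exact lintegral_congr fun z => by rw [hdet]

end Hessian

section Expectation

variable {k N : ℕ} {φ : ℝ → ℝ}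

lemma CritSet_eq_levelCrit (φ : ℝ → ℝ) {n m : ℕ} (hm : m ≠ 0) (ξ : Fin m → Fin n → ℝ)
    (B : Set ℝ) :
    CritSet φ ξ B = levelCrit (deriv φ) {y | 1 / (m : ℝ) * ∑ μ, φ (y μ) ∈ B} ξ := by
  have hg : ∀ x, gradL1 φ ξ x = (1 / (m : ℝ)) • tangentGrad (deriv φ) ξ x := fun x => by
    ext i
    simp [gradL1, tangentGrad]
  have hm' : 1 / (m : ℝ) ≠ 0 := one_div_ne_zero (Nat.cast_ne_zero.2 hm)
  ext x
  simp only [CritSet, levelCrit, hg, smul_eq_zero, hm', false_or, L1, mem_ofPred_eq]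

lemma level_factor {A m : ℝ} (hA : 0 < A) (hm : 0 < m) (N : ℕ) :
    (√A * √(2 * π))⁻¹ ^ N * m ^ N =
      √(m / (2 * π)) ^ N * rexp (-((N : ℝ) / 2) * Real.log (1 / m * A)) := by
  have h1 : rexp (-((N : ℝ) / 2) * Real.log (1 / m * A)) = (√(1 / m * A))⁻¹ ^ N := by
    rw [show -((N : ℝ) / 2) * Real.log (1 / m * A) = N * -(Real.log (1 / m * A) / 2) by ring,
      Real.exp_nat_mul, Real.exp_neg, ← Real.log_sqrt (by positivity),
      Real.exp_log (by positivity)]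
  rw [h1, ← mul_pow, ← mul_pow]
  congr 1
  have h2 : √(2 * π) ≠ 0 := (Real.sqrt_pos.2 (by positivity)).ne'
  have h3 : √A ≠ 0 := (Real.sqrt_pos.2 hA).ne'
  have h4 : √m ≠ 0 := (Real.sqrt_pos.2 hm).ne'
  have h5 : √(1 / m * A) = (√m)⁻¹ * √A := by
    rw [Real.sqrt_mul (by positivity), one_div, Real.sqrt_inv]
  rw [Real.sqrt_div hm.le, h5]
  field_simp
  rw [Real.sq_sqrt hm.le]

/-- The number of critical points at given dimensions, with explicit constant. -/
lemma toReal_ECrit (hφ : ContDiff ℝ 2 φ) (hZ : {y | deriv φ y = 0}.Countable) (hNk : N + 1 ≤ k)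
    {B : Set ℝ} (hB : MeasurableSet B) :
    (ECrit φ (N + 1) (k + 1) B).toReal =
      (N + 1 : ℕ) * (volume (Metric.ball (0 : EuclideanSpace ℝ (Fin (N + 1))) 1)).toReal *
        √((k + 1 : ℕ) / (2 * π)) ^ N *
        ∫ y, (if 1 / ((k + 1 : ℕ) : ℝ) * ∑ μ, φ (y μ) ∈ B then
          rexp (-((((N + 1 : ℕ) : ℝ) - 1) / 2) *
            Real.log (1 / ((k + 1 : ℕ) : ℝ) * ∑ μ, deriv φ (y μ) ^ 2)) *
              Edet φ (N + 1) (k + 1) y else 0) ∂(gaussVec (k + 1)) := by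
  have hψ : ContDiff ℝ 1 (deriv φ) := ((contDiff_succ_iff_deriv (n := 1)).1 hφ).2.2
  set S : Set (Fin (k + 1) → ℝ) := {y | 1 / ((k + 1 : ℕ) : ℝ) * ∑ μ, φ (y μ) ∈ B} with hS
  have hφc : Continuous φ := hφ.continuous
  have hSm : MeasurableSet S := by
    have hm : Measurable fun y : Fin (k + 1) → ℝ => 1 / ((k + 1 : ℕ) : ℝ) * ∑ μ, φ (y μ) := by
      fun_prop
    exact hm hB
  set F : (Fin (k + 1) → ℝ) → ℝ := fun y => if y ∈ S then
    rexp (-((((N + 1 : ℕ) : ℝ) - 1) / 2) *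
      Real.log (1 / ((k + 1 : ℕ) : ℝ) * ∑ μ, deriv φ (y μ) ^ 2)) *
        Edet φ (N + 1) (k + 1) y else 0 with hF
  have hFm : Measurable F := by
    have hd : Measurable fun y : Fin (k + 1) → ℝ =>
        1 / ((k + 1 : ℕ) : ℝ) * ∑ μ, deriv φ (y μ) ^ 2 := by
      have := measurable_deriv φ
      fun_prop
    exact Measurable.ite hSm (((hd.log.const_mul _).exp).mul (measurable_Edet φ _))
      measurable_const
  have hF0 : ∀ y, 0 ≤ F y := fun y => by
    simp only [hF]
    split_ifs
    · exact mul_nonneg (Real.exp_pos _).le (Edet_nonneg _ _ _ _)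
    · exact le_rfl
  set K : ℝ := √((k + 1 : ℕ) / (2 * π)) ^ N with hK
  have hK0 : 0 ≤ K := by positivity
  have hE : ECrit φ (N + 1) (k + 1) B =
      (N + 1 : ℕ) * volume (Metric.ball (0 : EuclideanSpace ℝ (Fin (N + 1))) 1) *
        (ENNReal.ofReal K * ∫⁻ y, ENNReal.ofReal (F y) ∂(gaussVec (k + 1))) := by
    rw [ECrit]
    simp only [CritSet_eq_levelCrit φ k.succ_ne_zero]
    rw [lintegral_encard_levelCrit_of_countable hψ hZ hNk hSm,
      ← lintegral_const_mul _ hFm.ennreal_ofReal]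
    congr 1
    refine lintegral_congr_ae ?_
    filter_upwards [ae_gaussVec_ne_zero hZ 0] with y hy
    by_cases hyS : y ∈ S
    · have hA : 0 < ∑ ρ, deriv φ (y ρ) ^ 2 := sum_sq_pos_of_ne (a := fun μ => deriv φ (y μ)) hy
      have hfac := level_factor hA (m := ((k + 1 : ℕ) : ℝ)) (by positivity) N
      simp only [hF, if_pos hyS]
      rw [lintegral_det_critMat, ← ENNReal.ofReal_mul (by positivity), ← ENNReal.ofReal_mul hK0,
        ← mul_assoc, hfac, mul_assoc]
      simp only [Nat.cast_add, Nat.cast_one, add_sub_cancel_right, hK]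
    · simp only [hF, if_neg hyS, ENNReal.ofReal_zero, mul_zero]
  rw [hE, ENNReal.toReal_mul, ENNReal.toReal_mul, ENNReal.toReal_mul, ENNReal.toReal_natCast,
    ENNReal.toReal_ofReal hK0, ← mul_assoc]
  congr 1
  exact (integral_eq_lintegral_of_nonneg_ae (.of_forall hF0) hFm.aestronglyMeasurable).symm

end Expectation

section Asymptotics

lemma tendsto_log_natCast_div : Tendsto (fun n : ℕ => Real.log n / n) atTop (𝓝 0) := by
  have h := (Real.isLittleO_log_id_atTop.comp_tendsto
    tendsto_natCast_atTop_atTop).tendsto_div_nhds_zero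
  exact h

lemma tendsto_log_factorial :
    Tendsto (fun n : ℕ => Real.log (n.factorial : ℝ) / n - Real.log n) atTop (𝓝 (-1)) := by
  have h1 : Tendsto (fun n : ℕ => Real.log (Stirling.stirlingSeq n) / n) atTop (𝓝 0) :=
    (Stirling.tendsto_stirlingSeq_sqrt_pi.log (Real.sqrt_pos.2 pi_pos).ne').div_atTop
      tendsto_natCast_atTop_atTop
  have h2 : Tendsto (fun n : ℕ => (1 / 2) * (Real.log 2 / n) + (1 / 2) * (Real.log n / n))
      atTop (𝓝 ((1 / 2) * 0 + (1 / 2) * 0)) :=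
    ((tendsto_const_nhds.div_atTop tendsto_natCast_atTop_atTop).const_mul _).add
      (tendsto_log_natCast_div.const_mul _)
  have h3 := (h1.add h2).sub_const 1
  rw [show (0 : ℝ) + ((1 / 2) * 0 + (1 / 2) * 0) - 1 = -1 by norm_num] at h3
  refine h3.congr' ?_
  filter_upwards [eventually_ge_atTop 1] with n hn
  have hn' : (n : ℝ) ≠ 0 := by positivity
  rw [Stirling.log_stirlingSeq_formula, Real.log_mul two_ne_zero hn',
    Real.log_div hn' (Real.exp_pos 1).ne', Real.log_exp]
  field_simp
  ring

lemma tendsto_log_Gamma_half :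
    Tendsto (fun n : ℕ => Real.log (Real.Gamma (n / 2 + 1)) / n - Real.log n / 2) atTop
      (𝓝 (-(1 + Real.log 2) / 2)) := by
  set r : ℕ → ℝ := fun n => Real.Gamma (n / 2 + 1) / Real.Gamma (n / 2 + 1 / 2) with hr
  have hr1 : ∀ n : ℕ, 3 ≤ n → 1 ≤ r n ∧ r n ≤ n := fun n hn => by
    have hn' : (3 : ℝ) ≤ n := by exact_mod_cast hn
    have hpos : 0 < Real.Gamma (n / 2 + 1 / 2) := Real.Gamma_pos_of_pos (by positivity)
    have hmono := Real.Gamma_strictMonoOn_Ici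
    have h1 : Real.Gamma (n / 2 + 1 / 2) ≤ Real.Gamma (n / 2 + 1) :=
      hmono.monotoneOn (show (2 : ℝ) ≤ _ by linarith) (show (2 : ℝ) ≤ _ by linarith) (by linarith)
    have h2 : Real.Gamma (n / 2 + 1) ≤ Real.Gamma (n / 2 + 1 / 2 + 1) :=
      hmono.monotoneOn (show (2 : ℝ) ≤ _ by linarith) (show (2 : ℝ) ≤ _ by linarith) (by linarith)
    rw [Real.Gamma_add_one (s := (n : ℝ) / 2 + 1 / 2) (by positivity)] at h2
    refine ⟨(one_le_div hpos).2 h1, (div_le_iff₀ hpos).2 (h2.trans ?_)⟩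
    exact mul_le_mul_of_nonneg_right (by linarith) hpos.le
  have h1 : Tendsto (fun n : ℕ => Real.log (r n) / n) atTop (𝓝 0) := by
    refine squeeze_zero' ?_ ?_ tendsto_log_natCast_div
    · filter_upwards [eventually_ge_atTop 3] with n hn
      exact div_nonneg (Real.log_nonneg (hr1 n hn).1) (Nat.cast_nonneg n)
    · filter_upwards [eventually_ge_atTop 3] with n hn
      have := hr1 n hn
      exact div_le_div_of_nonneg_right (Real.log_le_log (by linarith) this.2) (Nat.cast_nonneg n)
  have h2 : Tendsto (fun n : ℕ => Real.log √π / n) atTop (𝓝 0) :=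
    tendsto_const_nhds.div_atTop tendsto_natCast_atTop_atTop
  have h3 := ((((tendsto_log_factorial.sub_const (Real.log 2)).add h2).add h1).div_const 2)
  rw [show (-1 - Real.log 2 + 0 + 0) / 2 = -(1 + Real.log 2) / 2 by ring] at h3
  refine h3.congr' ?_
  filter_upwards [eventually_ge_atTop 1] with n hn
  have hn' : (n : ℝ) ≠ 0 := by positivity
  have hG1 : 0 < Real.Gamma (n / 2 + 1) := Real.Gamma_pos_of_pos (by positivity)
  have hG2 : 0 < Real.Gamma (n / 2 + 1 / 2) := Real.Gamma_pos_of_pos (by positivity)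
  have hdup := Real.Gamma_mul_Gamma_add_half ((n : ℝ) / 2 + 1 / 2)
  rw [show (n : ℝ) / 2 + 1 / 2 + 1 / 2 = n / 2 + 1 by ring,
    show 2 * ((n : ℝ) / 2 + 1 / 2) = n + 1 by ring, Real.Gamma_nat_eq_factorial,
    show (1 : ℝ) - (n + 1) = -n by ring] at hdup
  have hlog := congrArg Real.log hdup
  have hf : (n.factorial : ℝ) ≠ 0 := by positivity
  rw [Real.log_mul hG2.ne' hG1.ne', Real.log_mul (by positivity) (by positivity),
    Real.log_mul hf (by positivity), Real.log_rpow two_pos] at hlog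
  have hlr : Real.log (r n) = _ := Real.log_div hG1.ne' hG2.ne'
  rw [hlr]
  generalize Real.log (Real.Gamma ((n : ℝ) / 2 + 1)) = u at hlog ⊢
  generalize Real.log (Real.Gamma ((n : ℝ) / 2 + 1 / 2)) = v at hlog ⊢
  field_simp
  linarith

/-- The explicit prefactor of the complexity formula, normalized by its exponential rate. -/
def complexityConst (α : ℝ) (m : ℕ → ℕ) (n : ℕ) : ℝ :=
  n * (volume (Metric.ball (0 : EuclideanSpace ℝ (Fin n)) 1)).toReal *
    √(m n / (2 * π)) ^ (n - 1) * rexp (-(n * (1 + Real.log α) / 2))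

lemma tendsto_log_complexityConst {α : ℝ} (hα : 0 < α) {m : ℕ → ℕ}
    (hm : Tendsto (fun n => (m n : ℝ) / n) atTop (𝓝 α)) :
    Tendsto (fun n => Real.log (complexityConst α m n) / n) atTop (𝓝 0) := by
  have hinv : Tendsto (fun n : ℕ => 1 / (n : ℝ)) atTop (𝓝 0) :=
    tendsto_const_nhds.div_atTop tendsto_natCast_atTop_atTop
  have hlm : Tendsto (fun n : ℕ => Real.log ((m n : ℝ) / n)) atTop (𝓝 (Real.log α)) :=
    hm.log hα.ne'
  have h1 := ((((tendsto_log_natCast_div.mul_const (1 / 2)).add_const (Real.log π / 2)).sub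
    tendsto_log_Gamma_half).add (((hinv.const_sub 1).mul
      (hlm.sub_const (Real.log (2 * π)))).mul_const (1 / 2))).sub_const ((1 + Real.log α) / 2)
  have h0 : 0 * (1 / 2) + Real.log π / 2 - -(1 + Real.log 2) / 2 +
      (1 - 0) * (Real.log α - Real.log (2 * π)) * (1 / 2) - (1 + Real.log α) / 2 = 0 := by
    rw [Real.log_mul two_ne_zero pi_ne_zero]
    ring
  rw [h0] at h1
  refine h1.congr' ?_
  filter_upwards [eventually_ge_atTop 1, hm.eventually_const_lt hα] with n hn hmn
  obtain ⟨N, rfl⟩ : ∃ N, n = N + 1 := ⟨n - 1, by omega⟩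
  set n := N + 1 with hnN
  have hn' : (0 : ℝ) < n := by positivity
  have hm' : (0 : ℝ) < m n := by
    by_contra! hle
    exact absurd hmn (not_lt.2 (div_nonpos_of_nonpos_of_nonneg hle hn'.le))
  have hG : 0 < Real.Gamma ((n : ℝ) / 2 + 1) := Real.Gamma_pos_of_pos (by positivity)
  have hvol : (volume (Metric.ball (0 : EuclideanSpace ℝ (Fin n)) 1)).toReal =
      √π ^ n / Real.Gamma (n / 2 + 1) := by
    rw [EuclideanSpace.volume_ball, Fintype.card_fin, ENNReal.ofReal_one, one_pow, one_mul,
      ENNReal.toReal_ofReal (by positivity)]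
  have hs : √((m n : ℝ) / (2 * π)) ≠ 0 := (Real.sqrt_pos.2 (by positivity)).ne'
  have hp : √π ≠ 0 := (Real.sqrt_pos.2 pi_pos).ne'
  have hNn : ((n - 1 : ℕ) : ℝ) = n - 1 := by rw [hnN]; push_cast; simp
  have hx : 0 < √π ^ n / Real.Gamma ((n : ℝ) / 2 + 1) := by positivity
  have hlogC : Real.log (complexityConst α m n) =
      Real.log n + (n * (Real.log π / 2) - Real.log (Real.Gamma ((n : ℝ) / 2 + 1))) +
        ((n : ℝ) - 1) * ((Real.log (m n) - Real.log (2 * π)) / 2) -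
        n * (1 + Real.log α) / 2 := by
    rw [complexityConst, hvol,
      Real.log_mul (mul_ne_zero (mul_ne_zero hn'.ne' hx.ne') (pow_ne_zero _ hs))
        (Real.exp_pos _).ne', Real.log_exp,
      Real.log_mul (mul_ne_zero hn'.ne' hx.ne') (pow_ne_zero _ hs), Real.log_mul hn'.ne' hx.ne',
      Real.log_div (pow_ne_zero _ hp) hG.ne', Real.log_pow, Real.log_pow,
      Real.log_sqrt pi_pos.le, Real.log_sqrt (by positivity),
      Real.log_div hm'.ne' (by positivity), hNn]
    ring
  rw [hlogC, Real.log_div hm'.ne' hn'.ne']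
  generalize Real.log (Real.Gamma ((n : ℝ) / 2 + 1)) = u
  generalize Real.log (2 * π) = v
  field_simp
  ring

end Asymptotics

theorem complexity_at_finite_n
    (φ : ℝ → ℝ) (hφ : ContDiff ℝ 3 φ)
    (hdens : ∃ ε > (0 : ℝ), ∃ f : ℝ → ℝ, ContinuousOn f (Ioo (-ε) ε) ∧
      ∀ s ⊆ Ioo (-ε) ε, MeasurableSet s →
        Measure.map (fun y => deriv φ y) stdGauss s = ∫⁻ a in s, ENNReal.ofReal (f a))
    (α : ℝ) (hα : 1 < α)
    (m : ℕ → ℕ) (hm : Tendsto (fun n => (m n : ℝ) / n) atTop (𝓝 α))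
    (B : Set ℝ) (hBopen : IsOpen B) (hBint : B.OrdConnected) :
    ∃ C : ℕ → ℝ,
      Tendsto (fun n => Real.log (C n) / n) atTop (𝓝 0) ∧
      ∀ᶠ n : ℕ in atTop,
        (ECrit φ n (m n) B).toReal =
          C n * Real.exp ((n : ℝ) * (1 + Real.log α) / 2) *
            ∫ y,
              (if (1 / (m n : ℝ)) * ∑ μ, φ (y μ) ∈ B then
                Real.exp (-(((n : ℝ) - 1) / 2) *
                    Real.log ((1 / (m n : ℝ)) * ∑ μ, (deriv φ (y μ)) ^ 2)) *
                  Edet φ n (m n) y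
              else 0) ∂(gaussVec (m n)) := by
  refine ⟨complexityConst α m, tendsto_log_complexityConst (by linarith) hm, ?_⟩
  obtain ⟨ε, hε, f, hf, hlaw⟩ := hdens
  have hφ2 : ContDiff ℝ 2 φ := hφ.of_le (by norm_num)
  have hψ : ContDiff ℝ 1 (deriv φ) := ((contDiff_succ_iff_deriv (n := 1)).1 hφ2).2.2
  have hZ : {y | deriv φ y = 0}.Countable :=
    countable_zeros_of_deriv_ne_zero fun y hy => deriv_ne_zero_of_law hψ hε hf hlaw hy
  filter_upwards [eventually_ge_atTop 1, hm.eventually_const_lt hα] with n hn hmn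
  have hlt : n < m n := by
    have hn' : (0 : ℝ) < n := by exact_mod_cast hn
    rw [lt_div_iff₀ hn', one_mul] at hmn
    exact_mod_cast hmn
  obtain ⟨N, rfl⟩ : ∃ N, n = N + 1 := ⟨n - 1, by omega⟩
  have hconst : complexityConst α m (N + 1) *
      rexp (((N + 1 : ℕ) : ℝ) * (1 + Real.log α) / 2) = ((N + 1 : ℕ) : ℝ) *
        (volume (Metric.ball (0 : EuclideanSpace ℝ (Fin (N + 1))) 1)).toReal *
          √(m (N + 1) / (2 * π)) ^ N := by
    rw [complexityConst, mul_assoc _ (rexp _), ← Real.exp_add, neg_add_cancel, Real.exp_zero,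
      mul_one, Nat.add_sub_cancel]
  rw [hconst]
  generalize m (N + 1) = M at hlt ⊢
  obtain ⟨k, rfl⟩ : ∃ k, M = k + 1 := ⟨M - 1, by omega⟩
  exact toReal_ECrit hφ2 hZ (by omega) hBopen.measurableSet
end
end

section
/- Rank inequality for empirical spectral distributions: Let n ≥ 1 and let A, B be two real symmetric n×n matrices such that rank(A − B) = r. Denote by F_A (resp. F_B) the cumulative distribution function of the empirical spectral distribution of A (resp. B). Then sup_{t ∈ ℝ} |F_A(t) − F_B(t)| ≤ r/n. -/
/- STATEMENT 9: rank inequality for empirical spectral distributions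
(Lemma A.4 of the paper): if A, B are symmetric n×n matrices with
rank(A − B) = r, then sup_t |F_A(t) − F_B(t)| ≤ r/n. -/

open Matrix Finset
open scoped Classical

noncomputable section

/-- The c.d.f. of the empirical spectral distribution of a Hermitian real matrix:
`F_M(t) = (1/n) #{i : λ_i(M) ≤ t}`. -/
def esdCdf {n : ℕ} {M : Matrix (Fin n) (Fin n) ℝ} (hM : M.IsHermitian) (t : ℝ) : ℝ :=
  ((Finset.univ.filter fun i => hM.eigenvalues i ≤ t).card : ℝ) / n

lemma Matrix.IsHermitian.inner_toEuclideanLin_self {ι : Type*} [Fintype ι] [DecidableEq ι]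
    {M : Matrix ι ι ℝ} (hM : M.IsHermitian) (v : EuclideanSpace ℝ ι) :
    inner ℝ v (Matrix.toEuclideanLin M v) =
      ∑ i, hM.eigenvalues i * inner ℝ (hM.eigenvectorBasis i) v ^ 2 := by
  have hsymm := Matrix.isSymmetric_toEuclideanLin_iff.mpr hM
  have happly (i : ι) : Matrix.toEuclideanLin M (hM.eigenvectorBasis i) =
      hM.eigenvalues i • hM.eigenvectorBasis i := by
    ext k
    simpa using congrFun (hM.mulVec_eigenvectorBasis i) k
  rw [← hM.eigenvectorBasis.sum_inner_mul_inner]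
  refine Finset.sum_congr rfl fun i _ => ?_
  rw [← hsymm, happly, real_inner_smul_left, real_inner_comm]
  ring

lemma Matrix.IsHermitian.card_eigenvalues_le_add_rank {ι : Type*} [Fintype ι] [DecidableEq ι]
    {A B : Matrix ι ι ℝ} (hA : A.IsHermitian) (hB : B.IsHermitian) (t : ℝ) :
    (Finset.univ.filter fun i => hA.eigenvalues i ≤ t).card ≤
      (Finset.univ.filter fun i => hB.eigenvalues i ≤ t).card + (A - B).rank := by
  let f : EuclideanSpace ℝ ι →ₗ[ℝ] ({i // ¬ hA.eigenvalues i ≤ t} → ℝ) ×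
      (({i // hB.eigenvalues i ≤ t} → ℝ) × LinearMap.range (Matrix.toEuclideanLin (A - B))) :=
    (LinearMap.pi fun i : {i // ¬ hA.eigenvalues i ≤ t} =>
      (innerSL ℝ (hA.eigenvectorBasis i)).toLinearMap).prod
      ((LinearMap.pi fun i : {i // hB.eigenvalues i ≤ t} =>
        (innerSL ℝ (hB.eigenvectorBasis i)).toLinearMap).prod
        (Matrix.toEuclideanLin (A - B)).rangeRestrict)
  have hf : Function.Injective f := by
    rw [← LinearMap.ker_eq_bot, LinearMap.ker_eq_bot']
    intro v hv
    have hvA (i : ι) (hi : ¬ hA.eigenvalues i ≤ t) :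
        inner ℝ (hA.eigenvectorBasis i) v = 0 :=
      congrFun (congrArg Prod.fst hv) ⟨i, hi⟩
    have hvB (i : ι) (hi : hB.eigenvalues i ≤ t) :
        inner ℝ (hB.eigenvectorBasis i) v = 0 :=
      congrFun (congrArg (fun x => x.2.1) hv) ⟨i, hi⟩
    have hAB : Matrix.toEuclideanLin (A - B) v = 0 :=
      congrArg (fun x => (x.2.2 : EuclideanSpace ℝ ι)) hv
    have heq : Matrix.toEuclideanLin A v = Matrix.toEuclideanLin B v := by
      rw [map_sub, LinearMap.sub_apply] at hAB
      exact sub_eq_zero.mp hAB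
    have hle : inner ℝ v (Matrix.toEuclideanLin A v) ≤ t * ‖v‖ ^ 2 := by
      rw [hA.inner_toEuclideanLin_self, ← hA.eigenvectorBasis.sum_sq_inner_right v, Finset.mul_sum]
      refine Finset.sum_le_sum fun i _ => ?_
      by_cases hi : hA.eigenvalues i ≤ t
      · gcongr
      · simp [hvA i hi]
    have hterm (i : ι) :
        0 ≤ (hB.eigenvalues i - t) * inner ℝ (hB.eigenvectorBasis i) v ^ 2 := by
      by_cases hi : hB.eigenvalues i ≤ t
      · simp [hvB i hi]
      · exact mul_nonneg (by linarith) (sq_nonneg _)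
    have hsum : ∑ i, (hB.eigenvalues i - t) * inner ℝ (hB.eigenvectorBasis i) v ^ 2 = 0 := by
      refine le_antisymm ?_ (Finset.sum_nonneg fun i _ => hterm i)
      simp_rw [sub_mul]
      rw [Finset.sum_sub_distrib, ← Finset.mul_sum, ← hB.inner_toEuclideanLin_self,
        hB.eigenvectorBasis.sum_sq_inner_right, ← heq]
      linarith
    have hzero := (Finset.sum_eq_zero_iff_of_nonneg fun i _ => hterm i).mp hsum
    refine InnerProductSpace.ext_inner_left_basis hB.eigenvectorBasis.toBasis fun i => ?_
    rw [OrthonormalBasis.coe_toBasis, inner_zero_right]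
    by_cases hi : hB.eigenvalues i ≤ t
    · exact hvB i hi
    · have hne : hB.eigenvalues i - t ≠ 0 := (sub_pos.mpr (not_le.mp hi)).ne'
      simpa [hne] using hzero i (Finset.mem_univ i)
  have hrank : Module.finrank ℝ (LinearMap.range (Matrix.toEuclideanLin (A - B))) =
      (A - B).rank :=
    ((A - B).rank_eq_finrank_range_toLin (PiLp.basisFun 2 ℝ ι) (PiLp.basisFun 2 ℝ ι)).symm
  have hdim := LinearMap.finrank_le_finrank_of_injective hf
  rw [Module.finrank_prod, Module.finrank_prod, hrank, Module.finrank_fintype_fun_eq_card,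
    Module.finrank_fintype_fun_eq_card, finrank_euclideanSpace, Fintype.card_subtype,
    Fintype.card_subtype] at hdim
  have hcard := Finset.card_filter_add_card_filter_not (s := Finset.univ)
    fun i => hA.eigenvalues i ≤ t
  rw [Finset.card_univ] at hcard
  omega

theorem rank_inequality_esd
    (n : ℕ) (hn : 1 ≤ n)
    (A B : Matrix (Fin n) (Fin n) ℝ)
    (hA : A.IsHermitian) (hB : B.IsHermitian)
    (r : ℕ) (hr : (A - B).rank = r) :
    ∀ t : ℝ, |esdCdf hA t - esdCdf hB t| ≤ (r : ℝ) / n := by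
  intro t
  have hAB := hA.card_eigenvalues_le_add_rank hB t
  have hBA := hB.card_eigenvalues_le_add_rank hA t
  rw [← neg_sub A B, ← neg_one_smul ℝ (A - B), Matrix.rank_smul_of_mem_nonZeroDivisors _
    (mem_nonZeroDivisors_of_ne_zero (neg_ne_zero.mpr one_ne_zero)), hr] at hBA
  rw [hr] at hAB
  rw [esdCdf, esdCdf, ← sub_div, abs_div, Nat.abs_cast]
  gcongr
  rw [abs_sub_le_iff, sub_le_iff_le_add', sub_le_iff_le_add']
  exact ⟨mod_cast hAB, mod_cast hBA⟩
end
end
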